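/- arXiv:0908.2282 — 3 statements merged into one kernel-verified Lean document; each statement's English description precedes it below -/
import Mathlib

section
/- Let n ≥ 1, m ≥ 2, ε > 0, and let g₁, …, g_{m-1} : ℝ^n → ℝ be pairwise distinct non-constant monomial functions (i.e., g_l(h) = ∏_i h_i^{s⁽ˡ⁾ᵢ} with distinct nonzero exponent vectors s⁽ˡ⁾ ∈ ℕ^n). Then for Lebesgue-almost every h ∈ ℝ^n there exists κ > 0 with the following property: for every A > 0 and every integer f ≥ 1 and Q ≥ 1, any two distinct points of the received constellation { A·(u₀ + g₁(h)u₁ + ⋯ + g_{m-1}(h)u_{m-1}) : u₀,…,u_{m-1} ∈ ℤ, |u_l| ≤ fQ for all l } are at distance greater than κA/(2fQ)^{m-1+ε}. -/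
open MeasureTheory

/-- A set of large outer measure contains many well separated points. -/
lemma exists_separated_points {S : Set ℝ} {δ : ℝ} (n : ℕ)
    (hS : ENNReal.ofReal (2 * n * δ) < volume S) :
    ∃ s : Finset ℝ, s.card = n + 1 ∧ (↑s ⊆ S) ∧ ∀ x ∈ s, ∀ y ∈ s, x ≠ y → δ ≤ |x - y| := by
  induction n with
  | zero =>
    have hne : S.Nonempty := nonempty_of_measure_ne_zero (ne_bot_of_gt hS)
    obtain ⟨x, hx⟩ := hne
    exact ⟨{x}, by simp, by simpa using hx, by simp⟩
  | succ n ih =>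
    by_cases hδ : δ ≤ 0
    · have hinf : S.Infinite := by
        intro hfin
        rw [hfin.measure_zero] at hS
        simp at hS
      obtain ⟨s, hs, hc⟩ := hinf.exists_subset_card_eq (n + 1 + 1)
      exact ⟨s, hc, hs, fun x _ y _ _ => hδ.trans (abs_nonneg _)⟩
    push Not at hδ
    obtain ⟨s, hc, hs, hsep⟩ := ih (lt_of_le_of_lt (ENNReal.ofReal_le_ofReal (by
      push_cast; nlinarith)) hS)
    have hU : volume (⋃ x ∈ s, Metric.ball x δ) ≤ ENNReal.ofReal (2 * (n + 1 : ℕ) * δ) := by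
      refine (measure_biUnion_finset_le _ _).trans ?_
      simp only [Real.volume_ball, Finset.sum_const, hc, nsmul_eq_mul]
      rw [← ENNReal.ofReal_natCast, ← ENNReal.ofReal_mul (by positivity)]
      exact ENNReal.ofReal_le_ofReal (by ring_nf; rfl)
    obtain ⟨y, hy, hyU⟩ : (S \ ⋃ x ∈ s, Metric.ball x δ).Nonempty := by
      rw [Set.sdiff_nonempty]
      exact fun hsub => absurd (measure_mono hsub) (not_le.mpr (hU.trans_lt hS))
    simp only [Set.mem_iUnion, Metric.mem_ball, not_exists, not_lt, Real.dist_eq] at hyU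
    have hys : y ∉ s := fun h => absurd (hyU y h) (by simpa using hδ)
    refine ⟨insert y s, by rw [Finset.card_insert_of_notMem hys, hc], ?_, ?_⟩
    · rw [Finset.coe_insert]
      exact Set.insert_subset hy hs
    · intro a ha b hb hab
      rw [Finset.mem_insert] at ha hb
      rcases ha with rfl | ha <;> rcases hb with rfl | hb
      · exact absurd rfl hab
      · exact hyU _ hb
      · rw [abs_sub_comm]; exact hyU _ ha
      · exact hsep a ha b hb hab

/-- Sublevel sets of polynomials of degree at most `K` are small, relative to any value taken on
the interval. -/
lemma volume_polynomial_sublevel_le (K : ℕ) : ∃ c : ℝ, 0 < c ∧ c ≤ 1 ∧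
    ∀ p : Polynomial ℝ, p.natDegree ≤ K → ∀ a L y τ : ℝ, 0 < L → 0 < τ →
      y ∈ Set.Ico a (a + L) →
      volume {x ∈ Set.Ico a (a + L) | |p.eval x| < c * τ ^ K * |p.eval y|} ≤
        ENNReal.ofReal (τ * L) := by
  refine ⟨(((K : ℝ) + 1) * (2 * (K + 1)) ^ K)⁻¹, by positivity,
    inv_le_one_of_one_le₀ (one_le_mul_of_one_le_of_one_le (by simp)
      (one_le_pow₀ (by have : (0 : ℝ) ≤ K := by positivity
                       linarith))), ?_⟩
  intro p hp a L y τ hL hτ hy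
  by_contra! hvol
  set c : ℝ := (((K : ℝ) + 1) * (2 * (K + 1)) ^ K)⁻¹ with hc
  set δ : ℝ := τ * L / (2 * (K + 1)) with hδ
  have hδ0 : 0 < δ := by positivity
  obtain ⟨s, hcard, hsub, hsep⟩ := exists_separated_points (δ := δ) K (lt_of_le_of_lt
    (ENNReal.ofReal_le_ofReal (by
      rw [hδ, ← mul_div_assoc, div_le_iff₀ (by positivity)]
      nlinarith [mul_pos hτ hL])) hvol)
  have hint := Lagrange.eq_interpolate (s := s) (v := id) (f := p) (Set.injOn_id _) (by
    rw [hcard]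
    exact (Polynomial.degree_le_natDegree).trans_lt (by exact_mod_cast Nat.lt_succ_of_le hp))
  have hbasis : ∀ i ∈ s, |(Lagrange.basis s id i).eval y| ≤ (2 * (K + 1) / τ) ^ K := by
    intro i hi
    rw [Lagrange.basis, Polynomial.eval_prod, Finset.abs_prod]
    have hce : (s.erase i).card = K := by rw [Finset.card_erase_of_mem hi, hcard]; simp
    rw [← hce]
    rw [← Finset.prod_const]
    refine Finset.prod_le_prod (fun _ _ => abs_nonneg _) fun j hj => ?_
    rw [Finset.mem_erase] at hj
    simp only [Lagrange.basisDivisor, id, Polynomial.eval_mul, Polynomial.eval_C,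
      Polynomial.eval_sub, Polynomial.eval_X, abs_mul, abs_inv]
    have h1 := hsep i hi j hj.2 (Ne.symm hj.1)
    have h2 : |y - j| ≤ L := by
      have := (hsub hj.2).1
      rw [abs_le]; constructor <;> linarith [this.1, this.2, hy.1, hy.2]
    rw [hce, inv_mul_le_iff₀ (hδ0.trans_le h1)]
    calc |y - j| ≤ L := h2
      _ = δ * (2 * (K + 1) / τ) := by rw [hδ]; field_simp
      _ ≤ _ := by gcongr
  have hval : |p.eval y| ≤ ∑ i ∈ s, |p.eval i| * (2 * (K + 1) / τ) ^ K := by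
    conv_lhs => rw [hint]
    rw [Lagrange.interpolate_apply, Polynomial.eval_finsetSum]
    refine (Finset.abs_sum_le_sum_abs _ _).trans (Finset.sum_le_sum fun i hi => ?_)
    rw [Polynomial.eval_mul, Polynomial.eval_C, abs_mul]
    exact mul_le_mul_of_nonneg_left (hbasis i hi) (abs_nonneg _)
  have hlt : ∑ i ∈ s, |p.eval i| * (2 * (K + 1) / τ) ^ K <
      ∑ i ∈ s, (c * τ ^ K * |p.eval y|) * (2 * (K + 1) / τ) ^ K := by
    refine Finset.sum_lt_sum_of_nonempty (Finset.card_pos.mp (by omega)) fun i hi => ?_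
    exact mul_lt_mul_of_pos_right (hsub hi).2 (by positivity)
  refine absurd (hval.trans_lt hlt) (not_lt.mpr (le_of_eq ?_))
  rw [Finset.sum_const, hcard, nsmul_eq_mul, div_pow, hc]
  push_cast
  field_simp

/-- The index of the dyadic subinterval of level `m` of `[a, a + L)` that contains `x`. -/
noncomputable def dyadicIndex (a L : ℝ) (m : ℕ) (x : ℝ) : ℤ := ⌊(x - a) / L * 2 ^ m⌋

lemma dyadicIndex_eq_iff {a L : ℝ} (hL : 0 < L) {m : ℕ} {x : ℝ} {i : ℤ} :
    dyadicIndex a L m x = i ↔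
      x ∈ Set.Ico (a + L / 2 ^ m * i) (a + L / 2 ^ m * i + L / 2 ^ m) := by
  have h : (x - a) / L * 2 ^ m = (x - a) / (L / 2 ^ m) := by field_simp
  have hp : 0 < L / 2 ^ m := by positivity
  rw [dyadicIndex, Int.floor_eq_iff, h, le_div_iff₀ hp, div_lt_iff₀ hp, Set.mem_Ico]
  constructor <;> rintro ⟨h1, h2⟩ <;> constructor <;> linarith

lemma dyadicIndex_succ_div (a L : ℝ) (m : ℕ) (x : ℝ) :
    dyadicIndex a L (m + 1) x / 2 = dyadicIndex a L m x := by
  have := Int.floor_div_natCast ((x - a) / L * 2 ^ (m + 1)) 2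
  rw [dyadicIndex, dyadicIndex]
  push_cast at this
  rw [← this, pow_succ]
  congr 1
  ring

lemma dyadicIndex_eq_of_le {a L : ℝ} {m m' : ℕ} (h : m' ≤ m) {x y : ℝ}
    (hxy : dyadicIndex a L m x = dyadicIndex a L m y) :
    dyadicIndex a L m' x = dyadicIndex a L m' y := by
  induction m, h using Nat.le_induction with
  | base => exact hxy
  | succ m _ ih =>
    apply ih
    rw [← dyadicIndex_succ_div a L m x, ← dyadicIndex_succ_div a L m y, hxy]

lemma dyadicIndex_zero_eq {a L : ℝ} (hL : 0 < L) {x : ℝ} (hx : x ∈ Set.Ico a (a + L)) :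
    dyadicIndex a L 0 x = 0 := by
  rw [dyadicIndex_eq_iff hL]; simpa using hx

/-- If a countable measurable set of dyadic subintervals (selected by a stopping level) covers `B`
and each contains only a small proportion of `B`, then `B` is small. -/
lemma volume_le_of_dyadic_stopping {a L θ : ℝ} (hL : 0 < L) (hθ : 0 ≤ θ)
    {B : Set ℝ} (hBsub : B ⊆ Set.Ico a (a + L)) (halt : ℕ → ℤ → Prop)
    (h_halt : ∀ x ∈ B, ∃ m, halt m (dyadicIndex a L m x))
    (hsmall : ∀ m, ∀ x ∈ B, halt m (dyadicIndex a L m x) →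
      (∀ m' < m, ¬ halt m' (dyadicIndex a L m' x)) →
      volume (B ∩ {y | dyadicIndex a L m y = dyadicIndex a L m x}) ≤
        ENNReal.ofReal (θ * (L / 2 ^ m))) :
    volume B ≤ ENNReal.ofReal (θ * L) := by
  classical
  let cell : ℕ × ℤ → Set ℝ := fun q => {y | dyadicIndex a L q.1 y = q.2}
  let I : Set (ℕ × ℤ) := {q | halt q.1 q.2 ∧ (B ∩ cell q).Nonempty ∧
    ∀ y ∈ cell q, ∀ m' < q.1, ¬ halt m' (dyadicIndex a L m' y)}
  have hcell : ∀ q, cell q = Set.Ico (a + L / 2 ^ q.1 * q.2)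
      (a + L / 2 ^ q.1 * q.2 + L / 2 ^ q.1) := fun q => by
    ext y; exact dyadicIndex_eq_iff hL
  have hcover : B ⊆ ⋃ q : I, B ∩ cell q := by
    intro x hx
    have hex := h_halt x hx
    refine Set.mem_iUnion.mpr ⟨⟨(Nat.find hex, dyadicIndex a L (Nat.find hex) x),
      Nat.find_spec hex, ⟨x, hx, rfl⟩, fun y hy m' hm' => ?_⟩, hx, rfl⟩
    rw [dyadicIndex_eq_of_le hm'.le hy]
    exact Nat.find_min hex hm'
  have hdisj : Pairwise (Function.onFun Disjoint fun q : I => cell q) := by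
    rintro ⟨⟨m, i⟩, h1, _, h2⟩ ⟨⟨m', i'⟩, h1', _, h2'⟩ hne
    refine Set.disjoint_left.mpr fun x hx hx' => ?_
    have hx1 : dyadicIndex a L m x = i := hx
    have hx2 : dyadicIndex a L m' x = i' := hx'
    rcases lt_trichotomy m m' with h | h | h
    · exact h2' x hx' m h (by rw [hx1]; exact h1)
    · subst h
      exact hne (by simp [← hx1, ← hx2])
    · exact h2 x hx m' h (by rw [hx2]; exact h1')
  have hvol : ∀ q, volume (cell q) = ENNReal.ofReal (L / 2 ^ q.1) := fun q => by
    rw [hcell, Real.volume_Ico]; congr 1; ring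
  have hin : ⋃ q : I, cell q ⊆ Set.Ico a (a + L) := by
    refine Set.iUnion_subset ?_
    rintro ⟨⟨m, i⟩, _, ⟨x, hxB, hx⟩, _⟩ y hy
    have h0 := dyadicIndex_eq_of_le (Nat.zero_le m) (hy.trans hx.symm : dyadicIndex a L m y = _)
    rw [dyadicIndex_zero_eq hL (hBsub hxB), dyadicIndex_eq_iff hL] at h0
    simpa using h0
  calc volume B ≤ volume (⋃ q : I, B ∩ cell q) := measure_mono hcover
    _ ≤ ∑' q : I, volume (B ∩ cell q) := measure_iUnion_le _
    _ ≤ ∑' q : I, ENNReal.ofReal θ * volume (cell q) := by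
      refine ENNReal.tsum_le_tsum ?_
      rintro ⟨⟨m, i⟩, h1, ⟨x, hxB, hx⟩, h2⟩
      have hxi : dyadicIndex a L m x = i := hx
      subst hxi
      rw [hvol, ← ENNReal.ofReal_mul hθ]
      exact hsmall m x hxB h1 (h2 x hx)
    _ = ENNReal.ofReal θ * volume (⋃ q : I, cell q) := by
      rw [ENNReal.tsum_mul_left, measure_iUnion hdisj]
      intro q
      rw [hcell]
      exact measurableSet_Ico
    _ ≤ ENNReal.ofReal θ * volume (Set.Ico a (a + L)) := by gcongr
    _ = ENNReal.ofReal (θ * L) := by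
      rw [Real.volume_Ico, ENNReal.ofReal_mul hθ]; congr 2; ring

/-- The family `φ` satisfies a sublevel set estimate with exponent `1 / K` and constant `c`. -/
def SublevelBound {P : Type*} (φ : P → ℝ → ℝ) (c : ℝ) (K : ℕ) : Prop :=
  ∀ V, ∀ a L y τ : ℝ, 0 < L → 0 < τ → y ∈ Set.Ico a (a + L) →
    volume {x ∈ Set.Ico a (a + L) | φ V x < c * τ ^ K * φ V y} ≤ ENNReal.ofReal (τ * L)

/-- The point `x` is protected with respect to the chain `F` if `F` extends to a chain all of whose
new members are at most `1` at `x`, and everything comparable with it is at least `ε` at `x`. -/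
def IsProtected {P : Type*} [PartialOrder P] (φ : P → ℝ → ℝ) (ε : ℝ) (F : Set P) (x : ℝ) : Prop :=
  ∃ G : Set P, IsChain (· ≤ ·) (F ∪ G) ∧ (∀ V ∈ G, φ V x ≤ 1) ∧
    ∀ V, IsChain (· ≤ ·) (insert V (F ∪ G)) → V ∉ F → ε ≤ φ V x

lemma IsProtected.of_insert {P : Type*} [PartialOrder P] {φ : P → ℝ → ℝ} {ε : ℝ} {F : Set P}
    {x : ℝ} {V : P} (h : IsProtected φ ε (insert V F) x) (hV : ε ≤ φ V x) (hV1 : φ V x ≤ 1) :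
    IsProtected φ ε F x := by
  obtain ⟨G, hG, hG1, hGε⟩ := h
  refine ⟨insert V G, ?_, ?_, fun W hW hWF => ?_⟩
  · rwa [Set.union_insert, ← Set.insert_union]
  · rintro W (rfl | hW)
    exacts [hV1, hG1 W hW]
  · by_cases hWV : W = V
    · rwa [hWV]
    · rw [Set.union_insert, ← Set.insert_union] at hW
      exact hGε W hW (by simp [hWV, hWF])

/-- Sublevel bounds pass from an interval to either half. -/
lemma SublevelBound.exists_half {P : Type*} {φ : P → ℝ → ℝ} {c : ℝ} {K : ℕ}
    (h : SublevelBound φ c K) {V : P} {a b L y : ℝ} (hL : 0 < L)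
    (hy : y ∈ Set.Ico a (a + L)) (hsub : Set.Ico b (b + L / 2) ⊆ Set.Ico a (a + L)) :
    ∃ z ∈ Set.Ico b (b + L / 2), c * (1 / 4) ^ K * φ V y ≤ φ V z := by
  by_contra! hcon
  have h1 := h V a L y (1 / 4) hL (by norm_num) hy
  have h2 : Set.Ico b (b + L / 2) ⊆
      {x ∈ Set.Ico a (a + L) | φ V x < c * (1 / 4) ^ K * φ V y} :=
    fun z hz => ⟨hsub hz, hcon z hz⟩
  have h3 := (measure_mono h2).trans h1
  rw [Real.volume_Ico, ENNReal.ofReal_le_ofReal_iff (by positivity)] at h3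
  linarith

/-- Quantitative nondivergence for families of functions indexed by a partially ordered set. -/
theorem volume_not_isProtected_le {P : Type*} [PartialOrder P] {φ : P → ℝ → ℝ} {c : ℝ} {K k : ℕ}
    (hc0 : 0 < c) (hc1 : c ≤ 1) (hφ : SublevelBound φ c K) (hcont : ∀ V, Continuous (φ V))
    (hk : ∀ F : Set P, IsChain (· ≤ ·) F → F.encard ≤ k) {τ : ℝ} (hτ0 : 0 < τ) (hτ1 : τ ≤ 1)
    (n : ℕ) (F : Set P) (hF : IsChain (· ≤ ·) F) (hn : (k : ℕ∞) ≤ F.encard + n)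
    (a L s ε : ℝ) (hL : 0 < L) (hs0 : 0 < s) (hs1 : s ≤ 1)
    (hbig : ∀ V, IsChain (· ≤ ·) (insert V F) → V ∉ F → ∃ y ∈ Set.Ico a (a + L), s ≤ φ V y)
    (hε : ε ≤ c * τ ^ K * s * (c * (1 / 4) ^ K) ^ n) :
    volume {x ∈ Set.Ico a (a + L) | ¬ IsProtected φ ε F x} ≤ ENNReal.ofReal (n * τ * L) := by
  induction n generalizing F a L s with
  | zero =>
    convert zero_le (a := ENNReal.ofReal _)
    convert measure_empty (μ := volume) (α := ℝ)
    refine Set.eq_empty_of_forall_notMem fun x hx => hx.2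
      ⟨∅, by simpa using hF, by simp, fun V hV hVF => ?_⟩
    rw [Set.union_empty] at hV
    have h1 := hk _ hV
    rw [Set.encard_insert_of_notMem hVF] at h1
    rw [Nat.cast_zero, add_zero] at hn
    have hfin : F.encard ≠ ⊤ := fun h => by rw [h] at h1; simp at h1
    exact absurd (h1.trans hn) (not_le.mpr (ENat.lt_add_one_iff hfin |>.mpr le_rfl))
  | succ n ih =>
    set q : ℝ := c * (1 / 4) ^ K with hq
    have hq0 : 0 < q := by positivity
    have hq1 : q ≤ 1 := mul_le_one₀ hc1 (by positivity) (pow_le_one₀ (by norm_num) (by norm_num))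
    have hτK : τ ^ K ≤ 1 := pow_le_one₀ hτ0.le hτ1
    have hqn : q ^ n ≤ 1 := pow_le_one₀ hq0.le hq1
    have hετ : ε ≤ c * τ ^ K * (q * s) := by
      refine hε.trans ?_
      rw [pow_succ]
      calc c * τ ^ K * s * (q ^ n * q) = c * τ ^ K * (q * s) * q ^ n := by ring
        _ ≤ _ := mul_le_of_le_one_right (by positivity) hqn
    have hεs : ε ≤ s := by
      refine hετ.trans ?_
      calc c * τ ^ K * (q * s) ≤ 1 * 1 * (1 * s) := by gcongr
        _ = s := by ring
    set B := {x ∈ Set.Ico a (a + L) | ¬ IsProtected φ ε F x} with hB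
    let T : Set P := {V | IsChain (· ≤ ·) (insert V F) ∧ V ∉ F}
    let halt : ℕ → ℤ → Prop := fun m i => ∃ V ∈ T, ∀ y, dyadicIndex a L m y = i → φ V y < s
    refine volume_le_of_dyadic_stopping (θ := (n + 1 : ℕ) * τ) hL (by positivity)
      (fun x hx => hx.1) halt ?_ ?_
    · intro x hx
      have hnot : ¬ ∀ V ∈ T, ε ≤ φ V x := fun hall => hx.2
        ⟨∅, by simpa using hF, by simp, fun V hV hVF => hall V ⟨by simpa using hV, hVF⟩⟩
      push Not at hnot
      obtain ⟨V, hVT, hVx⟩ := hnot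
      obtain ⟨r, hr, hball⟩ := Metric.eventually_nhds_iff.mp
        ((hcont V).continuousAt.eventually_lt (continuousAt_const (y := s)) (hVx.trans_le hεs))
      obtain ⟨m, hm⟩ := exists_pow_lt_of_lt_one (show 0 < r / L by positivity)
        (show (1 / 2 : ℝ) < 1 by norm_num)
      refine ⟨m, V, hVT, fun y hy => hball ?_⟩
      have hx' := (dyadicIndex_eq_iff hL).mp (rfl : dyadicIndex a L m x = _)
      have hy' := (dyadicIndex_eq_iff hL).mp hy
      have hlen : L / 2 ^ m < r := by
        rw [lt_div_iff₀ hL] at hm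
        calc L / 2 ^ m = (1 / 2) ^ m * L := by rw [div_pow, one_pow]; ring
          _ < r := hm
      rw [Real.dist_eq, abs_lt]
      constructor <;> linarith [hx'.1, hx'.2, hy'.1, hy'.2]
    · intro m x hx ⟨V, hVT, hVs⟩ hmin
      obtain _ | m := m
      · exfalso
        obtain ⟨y, hy, hsy⟩ := hbig V hVT.1 hVT.2
        exact absurd (hVs y (by rw [dyadicIndex_zero_eq hL hy, dyadicIndex_zero_eq hL hx.1]))
          (not_lt.mpr hsy)
      set i := dyadicIndex a L (m + 1) x with hi
      set j := dyadicIndex a L m x with hj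
      set a' := a + L / 2 ^ (m + 1) * i with ha'
      set L' := L / 2 ^ (m + 1) with hL'
      have hL'0 : 0 < L' := by positivity
      have hcell : {y | dyadicIndex a L (m + 1) y = i} = Set.Ico a' (a' + L') := by
        ext y; exact dyadicIndex_eq_iff hL
      have hpar : {y | dyadicIndex a L m y = j} =
          Set.Ico (a + L / 2 ^ m * j) (a + L / 2 ^ m * j + L / 2 ^ m) := by
        ext y; exact dyadicIndex_eq_iff hL
      have hhalf : L / 2 ^ m / 2 = L' := by rw [hL', pow_succ]; field_simp
      have hbig' : ∀ W ∈ T, ∃ y ∈ Set.Ico a' (a' + L'), q * s ≤ φ W y := by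
        intro W hW
        have hns := hmin m (Nat.lt_succ_self m)
        simp only [halt, not_exists, not_and, not_forall, not_lt] at hns
        obtain ⟨y, hy, hsy⟩ := hns W hW
        obtain ⟨z, hz, hqz⟩ := hφ.exists_half (V := W) (b := a') (show 0 < L / 2 ^ m by positivity)
          (by rw [← hpar]; exact hy) (by
            rw [hhalf, ← hpar, ← hcell]
            exact fun y hy => dyadicIndex_eq_of_le m.le_succ (hy : _ = _))
        rw [hhalf] at hz
        exact ⟨z, hz, (mul_le_mul_of_nonneg_left hsy hq0.le).trans hqz⟩
      obtain ⟨y₀, hy₀, hqy₀⟩ := hbig' V hVT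
      have h1 : volume {x ∈ Set.Ico a' (a' + L') | φ V x < ε} ≤ ENNReal.ofReal (τ * L') := by
        refine le_trans (measure_mono ?_) (hφ V a' L' y₀ τ hL'0 hτ0 hy₀)
        exact fun x hx => ⟨hx.1, hx.2.trans_le
          (hετ.trans (mul_le_mul_of_nonneg_left hqy₀ (by positivity)))⟩
      have h2 := ih (insert V F) hVT.1 (by
          rw [Set.encard_insert_of_notMem hVT.2]
          refine hn.trans (le_of_eq ?_)
          push_cast
          ring) a' L' (q * s) hL'0 (by positivity) (mul_le_one₀ hq1 hs0.le hs1)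
        (fun W hW hWF => hbig' W ⟨hW.mono (Set.insert_subset_insert (Set.subset_insert _ _)),
          fun h => hWF (Set.mem_insert_of_mem _ h)⟩) (by
          refine hε.trans (le_of_eq ?_)
          rw [pow_succ]; ring)
      rw [hcell]
      have hsub : B ∩ Set.Ico a' (a' + L') ⊆ {x ∈ Set.Ico a' (a' + L') | φ V x < ε} ∪
          {x ∈ Set.Ico a' (a' + L') | ¬ IsProtected φ ε (insert V F) x} := by
        rintro z ⟨hzB, hz⟩
        by_cases hzε : φ V z < ε
        · exact Or.inl ⟨hz, hzε⟩
        · refine Or.inr ⟨hz, fun hprot => hzB.2 (hprot.of_insert (not_lt.mp hzε) ?_)⟩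
          have hz' : dyadicIndex a L (m + 1) z = i := by
            have : z ∈ {y | dyadicIndex a L (m + 1) y = i} := by rw [hcell]; exact hz
            exact this
          exact (hVs z hz').le.trans hs1
      refine (measure_mono hsub).trans ((measure_union_le _ _).trans ((add_le_add h1 h2).trans ?_))
      rw [← ENNReal.ofReal_add (by positivity) (by positivity)]
      refine ENNReal.ofReal_le_ofReal (le_of_eq ?_)
      push_cast
      ring

/-- Expansion of the determinant of a product in the (ordered) minors of the right factor. -/
lemma Matrix.det_mul_eq_sum_minors {R : Type*} [CommRing R] {j k : ℕ}
    (A : Matrix (Fin j) (Fin k) R) (W : Matrix (Fin k) (Fin j) R) :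
    (A * W).det = ∑ ρ : Fin j → Fin k, (∏ a, A a (ρ a)) * (W.submatrix ρ id).det := by
  have h1 : (A * W).det = (Matrix.detRowAlternating (R := R) (n := Fin j)).toMultilinearMap
      (fun a => ∑ l, A a l • W l) := by
    change (A * W).det = Matrix.det _
    congr 1
    ext a b
    simp [Matrix.mul_apply]
  rw [h1, MultilinearMap.map_sum]
  refine Finset.sum_congr rfl fun ρ _ => ?_
  rw [MultilinearMap.map_smul_univ]
  rfl

/-- The family of all maximal minors (with repetitions) of a matrix. -/
def maxMinors {k j : ℕ} (M : Matrix (Fin k) (Fin j) ℝ) (σ : Fin j → Fin k) : ℝ :=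
  (M.submatrix σ id).det

lemma maxMinors_mul_right {k j : ℕ} (M : Matrix (Fin k) (Fin j) ℝ)
    (G : Matrix (Fin j) (Fin j) ℝ) : maxMinors (M * G) = G.det • maxMinors M := by
  ext σ
  rw [maxMinors, Matrix.submatrix_mul M G σ id id Function.bijective_id, Matrix.det_mul]
  simp [maxMinors, mul_comm]

lemma maxMinors_ne_zero {k j : ℕ} {M : Matrix (Fin k) (Fin j) ℝ}
    (hM : LinearIndependent ℝ M.col) : maxMinors M ≠ 0 := by
  intro h0
  obtain ⟨g, hg⟩ := LinearMap.exists_leftInverse_of_injective M.mulVecLin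
    (LinearMap.ker_eq_bot.mpr (Matrix.mulVec_injective_iff.mpr hM))
  have h1 : LinearMap.toMatrix' g * M = 1 := by
    rw [← LinearMap.toMatrix'_id, ← hg, LinearMap.toMatrix'_comp,
      ← Matrix.toLin'_apply', LinearMap.toMatrix'_toLin']
  have h2 := Matrix.det_mul_eq_sum_minors (LinearMap.toMatrix' g) M
  rw [h1, Matrix.det_one] at h2
  have h3 : ∀ ρ, (M.submatrix ρ id).det = 0 := fun ρ => congrFun h0 ρ
  simp [h3] at h2

/-- Adding a column multiplies the size of the minors at most by the size of the column. -/
lemma norm_maxMinors_cons_le {k j : ℕ} (M : Matrix (Fin k) (Fin (j + 1)) ℝ) :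
    ‖maxMinors M‖ ≤ (j + 1) * (‖fun a => M a 0‖ * ‖maxMinors (M.submatrix id Fin.succ)‖) := by
  refine (pi_norm_le_iff_of_nonneg (by positivity)).mpr fun σ => ?_
  rw [maxMinors, Matrix.det_succ_column_zero]
  refine (norm_sum_le _ _).trans ?_
  have : ∀ i ∈ (Finset.univ : Finset (Fin (j + 1))),
      ‖(-1) ^ (i : ℕ) * (M.submatrix σ id) i 0 *
        ((M.submatrix σ id).submatrix i.succAbove Fin.succ).det‖ ≤
      ‖fun a => M a 0‖ * ‖maxMinors (M.submatrix id Fin.succ)‖ := by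
    intro i _
    rw [norm_mul, norm_mul, norm_pow, norm_neg, norm_one, one_pow, one_mul]
    exact mul_le_mul (norm_le_pi_norm (fun a => M a 0) (σ i))
      (norm_le_pi_norm (maxMinors (M.submatrix id Fin.succ)) (σ ∘ i.succAbove))
      (norm_nonneg _) (norm_nonneg _)
  refine (Finset.sum_le_sum this).trans (le_of_eq ?_)
  simp

/-- The real matrix underlying an integer matrix. -/
abbrev realMatrix {k j : ℕ} (W : Matrix (Fin k) (Fin j) ℤ) : Matrix (Fin k) (Fin j) ℝ :=
  W.map (fun z : ℤ => (z : ℝ))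

lemma maxMinors_realMatrix {k j : ℕ} (W : Matrix (Fin k) (Fin j) ℤ) (σ : Fin j → Fin k) :
    maxMinors (realMatrix W) σ = ((W.submatrix σ id).det : ℤ) := by
  rw [maxMinors, Int.cast_det]
  rfl

/-- The columns of `W` form a basis of the subspace `V`. -/
def IsIntegerBasis {k j : ℕ} (V : Submodule ℝ (Fin k → ℝ)) (W : Matrix (Fin k) (Fin j) ℤ) : Prop :=
  LinearIndependent ℝ (realMatrix W).col ∧ Submodule.span ℝ (Set.range (realMatrix W).col) = V

lemma IsIntegerBasis.finrank_eq {k j : ℕ} {V : Submodule ℝ (Fin k → ℝ)}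
    {W : Matrix (Fin k) (Fin j) ℤ} (h : IsIntegerBasis V W) : Module.finrank ℝ V = j := by
  rw [← h.2, finrank_span_eq_card h.1, Fintype.card_fin]

lemma IsIntegerBasis.exists_eq_mul {k j : ℕ} {V : Submodule ℝ (Fin k → ℝ)}
    {W W' : Matrix (Fin k) (Fin j) ℤ} (h : IsIntegerBasis V W) (h' : IsIntegerBasis V W') :
    ∃ G : Matrix (Fin j) (Fin j) ℝ, realMatrix W' = realMatrix W * G := by
  have hmem : ∀ b, ∃ g : Fin j → ℝ, ∑ i, g i • (realMatrix W).col i = (realMatrix W').col b := by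
    intro b
    rw [← Submodule.mem_span_range_iff_exists_fun, h.2, ← h'.2]
    exact Submodule.subset_span ⟨b, rfl⟩
  choose g hg using hmem
  refine ⟨Matrix.of fun i b => g b i, ?_⟩
  ext a b
  have := congrFun (hg b) a
  simp only [Finset.sum_apply, Pi.smul_apply, Matrix.col_apply, smul_eq_mul] at this
  rw [← this, Matrix.mul_apply]
  simp [mul_comm]

/-- Every subspace with an integer basis has one for which all images of the wedge product of the
basis are as small as possible. -/
lemma exists_minimal_integerBasis {k : ℕ} {V : Submodule ℝ (Fin k → ℝ)}
    (hV : ∃ (j : ℕ) (W : Matrix (Fin k) (Fin j) ℤ), IsIntegerBasis V W) :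
    ∃ (j : ℕ) (W : Matrix (Fin k) (Fin j) ℤ), IsIntegerBasis V W ∧
      ∀ (j' : ℕ) (W' : Matrix (Fin k) (Fin j') ℤ), IsIntegerBasis V W' →
        ∀ A : Matrix (Fin k) (Fin k) ℝ,
          ‖maxMinors (A * realMatrix W)‖ ≤ ‖maxMinors (A * realMatrix W')‖ := by
  classical
  have hex : ∃ N : ℕ, ∃ (j : ℕ) (W : Matrix (Fin k) (Fin j) ℤ), IsIntegerBasis V W ∧
      ∑ σ : Fin j → Fin k, (W.submatrix σ id).det.natAbs = N := by
    obtain ⟨j, W, hW⟩ := hV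
    exact ⟨_, j, W, hW, rfl⟩
  obtain ⟨j, W, hW, hN⟩ := Nat.find_spec hex
  refine ⟨j, W, hW, fun j' W' hW' A => ?_⟩
  obtain rfl : j = j' := hW.finrank_eq.symm.trans hW'.finrank_eq
  obtain ⟨G, hG⟩ := hW.exists_eq_mul hW'
  have hle : ∑ σ : Fin j → Fin k, (W.submatrix σ id).det.natAbs ≤
      ∑ σ : Fin j → Fin k, (W'.submatrix σ id).det.natAbs := by
    rw [hN]
    exact Nat.find_min' hex ⟨j, W', hW', rfl⟩
  have hcast : ∀ U : Matrix (Fin k) (Fin j) ℤ,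
      ((∑ σ : Fin j → Fin k, (U.submatrix σ id).det.natAbs : ℕ) : ℝ) =
        ∑ σ, |maxMinors (realMatrix U) σ| := by
    intro U
    push_cast
    refine Finset.sum_congr rfl fun σ _ => ?_
    rw [maxMinors_realMatrix, Nat.cast_natAbs, Int.cast_abs]
  have hle' : ∑ σ, |maxMinors (realMatrix W) σ| ≤ |G.det| * ∑ σ, |maxMinors (realMatrix W) σ| := by
    have : ((∑ σ : Fin j → Fin k, (W.submatrix σ id).det.natAbs : ℕ) : ℝ) ≤
      ((∑ σ : Fin j → Fin k, (W'.submatrix σ id).det.natAbs : ℕ) : ℝ) := by exact_mod_cast hle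
    rw [hcast, hcast, hG, maxMinors_mul_right] at this
    simpa [abs_mul, Finset.mul_sum] using this
  have hpos : 0 < ∑ σ, |maxMinors (realMatrix W) σ| := by
    obtain ⟨σ, hσ⟩ := Function.ne_iff.mp (maxMinors_ne_zero hW.1)
    exact Finset.sum_pos' (fun _ _ => abs_nonneg _) ⟨σ, Finset.mem_univ _, abs_pos.mpr hσ⟩
  have hG1 : 1 ≤ |G.det| := by
    by_contra! hlt
    nlinarith
  rw [hG, ← Matrix.mul_assoc, maxMinors_mul_right, norm_smul, Real.norm_eq_abs]
  exact le_mul_of_one_le_left (norm_nonneg _) hG1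

/-- The subspaces of `ℝ^k` spanned by integer vectors. -/
def RationalSubspace (k : ℕ) : Type :=
  {V : Submodule ℝ (Fin k → ℝ) //
    ∃ (j : ℕ) (W : Matrix (Fin k) (Fin j) ℤ), IsIntegerBasis V W}

instance (k : ℕ) : PartialOrder (RationalSubspace k) :=
  inferInstanceAs (PartialOrder {V : Submodule ℝ (Fin k → ℝ) //
    ∃ (j : ℕ) (W : Matrix (Fin k) (Fin j) ℤ), IsIntegerBasis V W})

lemma RationalSubspace.encard_chain_le {k : ℕ} (F : Set (RationalSubspace k))
    (hF : IsChain (· ≤ ·) F) : F.encard ≤ (k + 1 : ℕ) := by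
  have hinj : Set.InjOn (fun V : RationalSubspace k => Module.finrank ℝ V.1) F := by
    intro V hV W hW h
    rcases hF.total hV hW with hle | hle
    · exact Subtype.ext (Submodule.eq_of_le_of_finrank_eq hle h)
    · exact (Subtype.ext (Submodule.eq_of_le_of_finrank_eq hle h.symm)).symm
  rw [← hinj.encard_image]
  refine (Set.encard_le_encard (t := (Finset.range (k + 1) : Set ℕ)) ?_).trans ?_
  · rintro _ ⟨V, -, rfl⟩
    have := Submodule.finrank_le V.1
    rw [Module.finrank_fin_fun] at this
    simpa using Nat.lt_succ_of_le this
  · rw [Set.encard_coe_eq_coe_finsetCard, Finset.card_range]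

lemma isIntegerBasis_bot (k : ℕ) :
    IsIntegerBasis (⊥ : Submodule ℝ (Fin k → ℝ)) (Matrix.of fun _ (i : Fin 0) => i.elim0) :=
  ⟨linearIndependent_empty_type, by simp [Set.range_eq_empty]⟩

/-- Adjoining an integer vector to an integer basis. -/
lemma IsIntegerBasis.cons {k j : ℕ} {V : Submodule ℝ (Fin k → ℝ)}
    {W : Matrix (Fin k) (Fin j) ℤ} (h : IsIntegerBasis V W) {u : Fin k → ℤ}
    (hu : (fun a => (u a : ℝ)) ∉ V) :
    IsIntegerBasis (V ⊔ Submodule.span ℝ {fun a => (u a : ℝ)})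
      (Matrix.of fun a => Fin.cons (u a) (W a) : Matrix (Fin k) (Fin (j + 1)) ℤ) := by
  have hcol : (realMatrix (Matrix.of fun a => Fin.cons (u a) (W a) :
      Matrix (Fin k) (Fin (j + 1)) ℤ)).col =
      Fin.cons (fun a => (u a : ℝ)) (realMatrix W).col := by
    ext b a
    refine Fin.cases ?_ (fun b => ?_) b <;> simp [Matrix.col_apply]
  refine ⟨?_, ?_⟩
  · rw [hcol, linearIndependent_finCons, h.2]
    exact ⟨h.1, hu⟩
  · rw [hcol, Fin.range_cons, Submodule.span_insert, h.2, sup_comm]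

lemma exists_norm_apply_eq {ι : Type*} [Fintype ι] [Nonempty ι] (f : ι → ℝ) :
    ∃ i, |f i| = ‖f‖ := by
  by_contra! hne
  have h : ∀ i, ‖f i‖ < ‖f‖ := fun i => lt_of_le_of_ne (norm_le_pi_norm f i) (hne i)
  have h0 : 0 < ‖f‖ := (norm_nonneg _).trans_lt (h (Classical.arbitrary ι))
  exact lt_irrefl _ ((pi_norm_lt_iff h0).mpr h)

/-- Real linear combinations of distinct powers are bounded below on `[1, 2)` in terms of their
coefficients. -/
lemma exists_le_abs_sum_powers {d : ℕ} {e : Fin (d + 1) → ℕ} (he : Function.Injective e)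
    {c : Fin (d + 1) → ℝ} (hc : ∀ l, c l ≠ 0) :
    ∃ r : ℝ, 0 < r ∧ ∀ a : Fin (d + 1) → ℝ, ∃ y ∈ Set.Ico (1 : ℝ) (1 + 1),
      r * ‖a‖ ≤ |∑ l, a l * (c l * y ^ e l)| := by
  set M : ℕ := ∑ l, e l
  let y : Fin (M + 1) → ℝ := fun i => 1 + (i : ℝ) / (M + 1)
  have hyinj : Function.Injective y := by
    intro i i' h
    have hM : (M : ℝ) + 1 ≠ 0 := by positivity
    simp only [y, add_right_inj, div_left_inj' hM, Nat.cast_inj] at h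
    exact Fin.ext h
  have hy : ∀ i, y i ∈ Set.Ico (1 : ℝ) (1 + 1) := by
    intro i
    have hi : (i : ℝ) < M + 1 := by exact_mod_cast i.2
    constructor
    · simp only [y, le_add_iff_nonneg_right]
      positivity
    · simp only [y, add_lt_add_iff_left]
      exact (div_lt_one (by positivity)).mpr hi
  let T : (Fin (d + 1) → ℝ) →ₗ[ℝ] (Fin (M + 1) → ℝ) :=
    { toFun := fun a i => ∑ l, a l * (c l * y i ^ e l)
      map_add' := fun a b => by
        ext i
        simp [add_mul, Finset.sum_add_distrib]
      map_smul' := fun t a => by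
        ext i
        simp [Finset.mul_sum, mul_assoc] }
  have hT : LinearMap.ker T = ⊥ := by
    refine LinearMap.ker_eq_bot'.mpr fun a ha => ?_
    let p : Polynomial ℝ := ∑ l, Polynomial.C (a l * c l) * Polynomial.X ^ e l
    have hp : p = 0 := by
      refine Polynomial.eq_zero_of_natDegree_lt_card_of_eval_eq_zero p hyinj (fun i => ?_) ?_
      · have := congrFun ha i
        simpa [p, Polynomial.eval_finsetSum, T, mul_assoc] using this
      · rw [Fintype.card_fin, Nat.lt_succ_iff]
        refine Polynomial.natDegree_sum_le_of_forall_le _ _ fun l hl => ?_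
        exact (Polynomial.natDegree_C_mul_X_pow_le _ _).trans
          (Finset.single_le_sum (fun _ _ => Nat.zero_le _) hl)
    ext l
    have hcoef : p.coeff (e l) = a l * c l := by
      simp only [p, Polynomial.finsetSum_coeff, Polynomial.coeff_C_mul, Polynomial.coeff_X_pow]
      rw [Finset.sum_eq_single l]
      · simp
      · intro l' _ hl'
        rw [if_neg (fun h => hl' (he h).symm), mul_zero]
      · simp
    rw [hp, Polynomial.coeff_zero] at hcoef
    simpa [hc l] using hcoef.symm
  obtain ⟨K, hK0, hK⟩ := T.exists_antilipschitzWith hT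
  refine ⟨(K : ℝ)⁻¹, by positivity, fun a => ?_⟩
  obtain ⟨i, hi⟩ := exists_norm_apply_eq (T a)
  refine ⟨y i, hy i, ?_⟩
  change _ ≤ |T a i|
  rw [hi, inv_mul_le_iff₀ (by exact_mod_cast hK0)]
  have := hK.le_mul_dist a 0
  simpa using this

/-- The matrix sending an integer vector `u` to `N₁ ∑ cₗ x ^ eₗ uₗ` followed by
`N₂ u₁, …, N₂ u_d`. -/
def flowMatrix {d : ℕ} (e : Fin (d + 1) → ℕ) (c : Fin (d + 1) → ℝ) (N₁ N₂ x : ℝ) :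
    Matrix (Fin (d + 1)) (Fin (d + 1)) ℝ :=
  Matrix.of fun i l => if i = 0 then N₁ * (c l * x ^ e l) else if i = l then N₂ else 0

lemma flowMatrix_mul_row_zero {d j : ℕ} (e : Fin (d + 1) → ℕ) (c : Fin (d + 1) → ℝ)
    (N₁ N₂ x : ℝ) (M : Matrix (Fin (d + 1)) (Fin j) ℝ) (b : Fin j) :
    (flowMatrix e c N₁ N₂ x * M) 0 b = N₁ * ∑ l, c l * x ^ e l * M l b := by
  simp [Matrix.mul_apply, flowMatrix, Finset.mul_sum, mul_assoc]

lemma flowMatrix_mul_row {d j : ℕ} (e : Fin (d + 1) → ℕ) (c : Fin (d + 1) → ℝ)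
    (N₁ N₂ x : ℝ) (M : Matrix (Fin (d + 1)) (Fin j) ℝ) {i : Fin (d + 1)} (hi : i ≠ 0) (b : Fin j) :
    (flowMatrix e c N₁ N₂ x * M) i b = N₂ * M i b := by
  simp [Matrix.mul_apply, flowMatrix, hi]

lemma exists_polynomial_maxMinors {d j : ℕ} (e : Fin (d + 1) → ℕ) (c : Fin (d + 1) → ℝ)
    (N₁ N₂ : ℝ) (M : Matrix (Fin (d + 1)) (Fin j) ℝ) (σ : Fin j → Fin (d + 1)) :
    ∃ p : Polynomial ℝ, p.natDegree ≤ j * ∑ l, e l ∧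
      ∀ x, maxMinors (flowMatrix e c N₁ N₂ x * M) σ = p.eval x := by
  let L : Fin (d + 1) → Fin (d + 1) → Polynomial ℝ := fun i l =>
    if i = 0 then Polynomial.C (N₁ * c l) * Polynomial.X ^ e l else
      if i = l then Polynomial.C N₂ else 0
  have hdeg : ∀ i l, (L i l).natDegree ≤ ∑ l, e l := by
    intro i l
    simp only [L]
    split_ifs
    · exact (Polynomial.natDegree_C_mul_X_pow_le _ _).trans
        (Finset.single_le_sum (fun _ _ => Nat.zero_le _) (Finset.mem_univ l))
    · simp
    · simp
  have heval : ∀ i l x, (L i l).eval x = flowMatrix e c N₁ N₂ x i l := by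
    intro i l x
    simp only [L, flowMatrix, Matrix.of_apply]
    split_ifs <;> simp [mul_assoc]
  refine ⟨∑ ρ : Fin j → Fin (d + 1), (∏ a, L (σ a) (ρ a)) *
    Polynomial.C (M.submatrix ρ id).det, ?_, fun x => ?_⟩
  · refine Polynomial.natDegree_sum_le_of_forall_le _ _ fun ρ _ => ?_
    refine (Polynomial.natDegree_mul_C_le _ _).trans ((Polynomial.natDegree_prod_le _ _).trans ?_)
    refine (Finset.sum_le_sum fun a _ => hdeg (σ a) (ρ a)).trans (le_of_eq ?_)
    simp
  · rw [maxMinors, Matrix.submatrix_mul _ M σ id id Function.bijective_id,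
      Matrix.det_mul_eq_sum_minors, Polynomial.eval_finsetSum]
    refine Finset.sum_congr rfl fun ρ _ => ?_
    simp [Polynomial.eval_prod, heval]

/-- The covolume of every integer subspace is bounded below somewhere on `[1, 2)`. -/
lemma exists_le_norm_maxMinors {d j : ℕ} {e : Fin (d + 1) → ℕ} {c : Fin (d + 1) → ℝ} {r : ℝ}
    (hr0 : 0 < r) (hr1 : r ≤ 1)
    (hr : ∀ a : Fin (d + 1) → ℝ, ∃ y ∈ Set.Ico (1 : ℝ) (1 + 1),
      r * ‖a‖ ≤ |∑ l, a l * (c l * y ^ e l)|)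
    {N₁ N₂ : ℝ} (hN₂ : 0 < N₂) (hN₂' : N₂ ≤ 1) (hN : 1 ≤ N₁ * N₂ ^ d)
    {W : Matrix (Fin (d + 1)) (Fin j) ℤ} (hW : LinearIndependent ℝ (realMatrix W).col) :
    ∃ y ∈ Set.Ico (1 : ℝ) (1 + 1), r ≤ ‖maxMinors (flowMatrix e c N₁ N₂ y * realMatrix W)‖ := by
  have hN₁ : 0 < N₁ := by
    by_contra! h
    have := mul_nonpos_of_nonpos_of_nonneg h (pow_nonneg hN₂.le d)
    linarith
  obtain ⟨T, hT⟩ := Function.ne_iff.mp (maxMinors_ne_zero hW)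
  obtain _ | j := j
  · refine ⟨1, by norm_num, hr1.trans ?_⟩
    refine le_trans ?_ (norm_le_pi_norm _ T)
    simp [maxMinors]
  have hj : j ≤ d := by
    have := hW.fintype_card_le_finrank
    simpa using this
  have hTinj : Function.Injective T := by
    intro a b hab
    by_contra hne
    exact hT (Matrix.det_zero_of_row_eq hne (by
      ext l
      simp [Matrix.submatrix_apply, hab]))
  obtain ⟨a₀, ha₀⟩ : ∃ a₀, ∀ b, b ≠ a₀ → T b ≠ 0 := by
    by_cases h : ∃ a₀, T a₀ = 0
    · obtain ⟨a₀, h⟩ := h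
      exact ⟨a₀, fun b hb hTb => hb (hTinj (hTb.trans h.symm))⟩
    · exact ⟨0, fun b _ hTb => h ⟨b, hTb⟩⟩
  let a : Fin (d + 1) → ℝ := fun l => maxMinors (realMatrix W) (Function.update T a₀ l)
  have ha1 : 1 ≤ ‖a‖ := by
    refine le_trans ?_ (norm_le_pi_norm a (T a₀))
    simp only [a, Function.update_eq_self]
    rw [Pi.zero_apply, maxMinors_realMatrix] at hT
    rw [maxMinors_realMatrix, Real.norm_eq_abs]
    exact_mod_cast Int.one_le_abs (by exact_mod_cast hT)
  obtain ⟨y, hy, hry⟩ := hr a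
  refine ⟨y, hy, ?_⟩
  refine le_trans ?_ (norm_le_pi_norm _ (Function.update T a₀ 0))
  have hdet : maxMinors (flowMatrix e c N₁ N₂ y * realMatrix W) (Function.update T a₀ 0) =
      N₁ * N₂ ^ j * ∑ l, a l * (c l * y ^ e l) := by
    have h1 : maxMinors (flowMatrix e c N₁ N₂ y * realMatrix W) (Function.update T a₀ 0) =
        (Matrix.detRowAlternating (R := ℝ) (n := Fin (j + 1)))
          (Function.update (fun b => N₂ • realMatrix W (T b)) a₀
            (∑ l, (N₁ * (c l * y ^ e l)) • realMatrix W l)) := by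
      change Matrix.det _ = Matrix.det _
      congr 1
      ext b l
      rw [Matrix.submatrix_apply]
      by_cases hb : b = a₀
      · subst hb
        rw [Function.update_self, Function.update_self, id, flowMatrix_mul_row_zero]
        simp [Finset.mul_sum, mul_assoc]
      · rw [Function.update_of_ne hb, Function.update_of_ne hb, id,
          flowMatrix_mul_row _ _ _ _ _ _ (ha₀ b hb)]
        simp
    rw [h1, AlternatingMap.map_update_sum, Finset.mul_sum]
    refine Finset.sum_congr rfl fun l _ => ?_
    rw [AlternatingMap.map_update_smul]
    have h2 : Function.update (fun b => N₂ • realMatrix W (T b)) a₀ (realMatrix W l) =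
        fun b => (Function.update (fun _ => N₂) a₀ 1 b) •
          realMatrix W (Function.update T a₀ l b) := by
      ext b i
      by_cases hb : b = a₀
      · subst hb; simp
      · simp [Function.update_of_ne hb]
    have h3 := (Matrix.detRowAlternating (R := ℝ) (n := Fin (j + 1))).toMultilinearMap.map_smul_univ
      (Function.update (fun _ => N₂) a₀ 1) (fun b => realMatrix W (Function.update T a₀ l b))
    rw [AlternatingMap.coe_multilinearMap] at h3
    rw [h2, h3, Finset.prod_update_of_mem (Finset.mem_univ _)]
    have h4 : (Matrix.detRowAlternating (R := ℝ) (n := Fin (j + 1)))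
        (fun b => realMatrix W (Function.update T a₀ l b)) = a l := rfl
    rw [h4]
    simp [Finset.card_sdiff]
    ring
  rw [hdet, norm_mul, Real.norm_eq_abs, Real.norm_eq_abs, abs_of_pos (by positivity)]
  have hN' : 1 ≤ N₁ * N₂ ^ j := hN.trans
    (mul_le_mul_of_nonneg_left (pow_le_pow_of_le_one hN₂.le hN₂' hj) hN₁.le)
  calc r ≤ r * ‖a‖ := le_mul_of_one_le_right hr0.le ha1
    _ ≤ _ := hry
    _ ≤ _ := le_mul_of_one_le_left (abs_nonneg _) hN'

/-- At a protected point, the lattice has no short nonzero vectors. -/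
lemma le_norm_mulVec_of_isProtected {k : ℕ} {j : RationalSubspace k → ℕ}
    {W : ∀ V, Matrix (Fin k) (Fin (j V)) ℤ} (hW : ∀ V, IsIntegerBasis V.1 (W V))
    (A : ℝ → Matrix (Fin k) (Fin k) ℝ)
    (hmin : ∀ V (j' : ℕ) (W' : Matrix (Fin k) (Fin j') ℤ), IsIntegerBasis V.1 W' → ∀ x,
      ‖maxMinors (A x * realMatrix (W V))‖ ≤ ‖maxMinors (A x * realMatrix W')‖)
    {ε x : ℝ} (hx : IsProtected (fun V x => ‖maxMinors (A x * realMatrix (W V))‖) ε ∅ x)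
    {u : Fin k → ℤ} (hu : u ≠ 0) :
    ε ≤ k * ‖(A x).mulVec (fun a => (u a : ℝ))‖ := by
  obtain ⟨G, hG, hG1, hGε⟩ := hx
  simp only [Set.empty_union] at hG hGε
  set v : Fin k → ℝ := fun a => (u a : ℝ) with hv
  have hv0 : v ≠ 0 := fun h => hu (by
    ext a
    have := congrFun h a
    simpa [hv] using this)
  let bot : RationalSubspace k := ⟨⊥, _, _, isIntegerBasis_bot k⟩
  have hbot : ∀ V, bot ≤ V := fun V => (bot_le : (⊥ : Submodule ℝ (Fin k → ℝ)) ≤ V.1)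
  have hbot1 : ‖maxMinors (A x * realMatrix (W bot))‖ ≤ 1 := by
    refine (hmin bot _ _ (isIntegerBasis_bot k) x).trans ?_
    refine (pi_norm_le_iff_of_nonneg zero_le_one).mpr fun σ => ?_
    simp [maxMinors]
  have hchain : IsChain (· ≤ ·) (insert bot G) := hG.insert fun V _ _ => Or.inl (hbot V)
  have hle1 : ∀ V ∈ insert bot G, ‖maxMinors (A x * realMatrix (W V))‖ ≤ 1 := by
    rintro V (rfl | hV)
    exacts [hbot1, hG1 V hV]
  have hfin : {V ∈ insert bot G | v ∉ V.1}.Finite := by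
    refine Set.Finite.subset (Set.finite_of_encard_le_coe
      (RationalSubspace.encard_chain_le _ hchain)) fun V hV => hV.1
  obtain ⟨V₀, ⟨hV₀, hvV₀⟩, hmax⟩ := hfin.exists_maximal
    ⟨bot, Set.mem_insert _ _, fun h => hv0 ((Submodule.mem_bot ℝ).mp h)⟩
  have hbasis := (hW V₀).cons (u := u) hvV₀
  let V₁ : RationalSubspace k := ⟨_, _, _, hbasis⟩
  have hle01 : V₀ ≤ V₁ := (le_sup_left : V₀.1 ≤ V₀.1 ⊔ Submodule.span ℝ {v})
  have hcomp : IsChain (· ≤ ·) (insert V₁ G) := by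
    refine hG.insert fun V hV _ => ?_
    have hV' : V ∈ insert bot G := Set.mem_insert_of_mem _ hV
    by_cases hvV : v ∈ V.1
    · left
      have h01 : V₀ ≤ V := by
        rcases hchain.total hV₀ hV' with h | h
        · exact h
        · exact absurd hvV (fun hv' => hvV₀ (h hv'))
      exact (sup_le h01 ((Submodule.span_singleton_le_iff_mem _ _).mpr hvV) :
        V₀.1 ⊔ Submodule.span ℝ {v} ≤ V.1)
    · right
      rcases hchain.total hV₀ hV' with h | h
      · exact (hmax ⟨hV', hvV⟩ h).trans hle01
      · exact h.trans hle01
  have h1 := (hGε V₁ hcomp (Set.notMem_empty _)).trans (hmin V₁ _ _ hbasis x)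
  have h2 := norm_maxMinors_cons_le (A x * realMatrix (Matrix.of fun a =>
    Fin.cons (u a) (W V₀ a) : Matrix (Fin k) (Fin (j V₀ + 1)) ℤ))
  have h3 : (fun a => (A x * realMatrix (Matrix.of fun a =>
      Fin.cons (u a) (W V₀ a) : Matrix (Fin k) (Fin (j V₀ + 1)) ℤ)) a 0) = (A x).mulVec v := by
    ext a
    simp [Matrix.mul_apply, Matrix.mulVec, dotProduct, hv]
  have h4 : (A x * realMatrix (Matrix.of fun a =>
      Fin.cons (u a) (W V₀ a) : Matrix (Fin k) (Fin (j V₀ + 1)) ℤ)).submatrix id Fin.succ =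
      A x * realMatrix (W V₀) := by
    ext a b
    simp [Matrix.mul_apply]
  rw [h3, h4] at h2
  have hj : ((j V₀ : ℝ) + 1) ≤ k := by
    have := hbasis.1.fintype_card_le_finrank
    simp only [Fintype.card_fin, Module.finrank_fin_fun] at this
    exact_mod_cast this
  calc ε ≤ _ := h1
    _ ≤ _ := h2
    _ ≤ k * (‖(A x).mulVec v‖ * 1) := by
      gcongr
      exact hle1 V₀ hV₀
    _ = _ := by ring

/-- Quantitative nondivergence for the curve `x ↦ (cₗ x ^ eₗ)`. -/
theorem exists_volume_short_vector_le {d : ℕ} {e : Fin (d + 1) → ℕ} (he : Function.Injective e)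
    {c : Fin (d + 1) → ℝ} (hc : ∀ l, c l ≠ 0) :
    ∃ C : ℝ, 0 < C ∧ ∃ K : ℕ, 1 ≤ K ∧ ∀ N₁ N₂ : ℝ, 0 < N₂ → N₂ ≤ 1 → 1 ≤ N₁ * N₂ ^ d →
      ∀ τ : ℝ, 0 < τ → τ ≤ 1 →
        volume {x ∈ Set.Ico (1 : ℝ) (1 + 1) | ∃ u : Fin (d + 1) → ℤ, u ≠ 0 ∧
          ‖(flowMatrix e c N₁ N₂ x).mulVec (fun a => (u a : ℝ))‖ < C * τ ^ K} ≤
        ENNReal.ofReal ((d + 2) * τ) := by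
  set K : ℕ := (d + 1) * ∑ l, e l + 1 with hK
  obtain ⟨c₀, hc₀, hc₁, hpoly⟩ := volume_polynomial_sublevel_le K
  obtain ⟨r', hr'0, hr'⟩ := exists_le_abs_sum_powers he hc
  set r := min r' 1 with hr
  have hr0 : 0 < r := lt_min hr'0 one_pos
  have hrle : ∀ a : Fin (d + 1) → ℝ, ∃ y ∈ Set.Ico (1 : ℝ) (1 + 1),
      r * ‖a‖ ≤ |∑ l, a l * (c l * y ^ e l)| := fun a => by
    obtain ⟨y, hy, hya⟩ := hr' a
    exact ⟨y, hy, le_trans (by gcongr; exact min_le_left _ _) hya⟩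
  refine ⟨c₀ * r * (c₀ * (1 / 4) ^ K) ^ (d + 2) / (d + 1), by positivity, K, by omega, ?_⟩
  intro N₁ N₂ hN₂ hN₂' hN τ hτ0 hτ1
  choose j W hW hmin using fun V : RationalSubspace (d + 1) => exists_minimal_integerBasis V.2
  let φ : RationalSubspace (d + 1) → ℝ → ℝ :=
    fun V x => ‖maxMinors (flowMatrix e c N₁ N₂ x * realMatrix (W V))‖
  have hj : ∀ V, j V ≤ d + 1 := fun V => by
    have := (hW V).1.fintype_card_le_finrank
    simpa using this
  choose p hpdeg hp using fun V σ => exists_polynomial_maxMinors e c N₁ N₂ (realMatrix (W V)) σ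
  have hpK : ∀ V σ, (p V σ).natDegree ≤ K := fun V σ =>
    (hpdeg V σ).trans ((Nat.mul_le_mul_right _ (hj V)).trans (Nat.le_succ _))
  have hsub : SublevelBound φ c₀ K := by
    intro V a L y τ hL hτ hy
    obtain ⟨σ, hσ⟩ := exists_norm_apply_eq
      (maxMinors (flowMatrix e c N₁ N₂ y * realMatrix (W V)))
    refine le_trans (measure_mono ?_) (hpoly (p V σ) (hpK V σ) a L y τ hL hτ hy)
    rintro x ⟨hx, hlt⟩
    refine ⟨hx, ?_⟩
    rw [← hp, ← hp, hσ]
    exact (norm_le_pi_norm (maxMinors (flowMatrix e c N₁ N₂ x * realMatrix (W V))) σ).trans_lt hlt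
  have hcont : ∀ V, Continuous (φ V) := by
    intro V
    refine Continuous.norm (continuous_pi fun σ => ?_)
    simp only [hp]
    exact (p V σ).continuous
  set ε := c₀ * τ ^ K * r * (c₀ * (1 / 4) ^ K) ^ (d + 2) with hε
  have hmain := volume_not_isProtected_le hc₀ hc₁ hsub hcont
    (k := d + 1 + 1) (fun F hF => RationalSubspace.encard_chain_le F hF)
    hτ0 hτ1 (d + 2) ∅ (by simp [IsChain]) (by rw [Set.encard_empty, zero_add]) 1 1 r ε one_pos hr0 (min_le_right _ _)
    (fun V _ _ => exists_le_norm_maxMinors hr0 (min_le_right _ _) hrle hN₂ hN₂' hN (hW V).1)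
    le_rfl
  refine (measure_mono ?_).trans (hmain.trans (ENNReal.ofReal_le_ofReal (by push_cast; linarith)))
  rintro x ⟨hx, u, hu, hlt⟩
  refine ⟨hx, fun hprot => ?_⟩
  have h := le_norm_mulVec_of_isProtected hW (flowMatrix e c N₁ N₂)
    (fun V j' W' hW' x => hmin V j' W' hW' _) hprot hu
  push_cast at h
  have h' : (d + 1 : ℝ) * ‖(flowMatrix e c N₁ N₂ x).mulVec (fun a => (u a : ℝ))‖ < ε := by
    calc _ < (d + 1 : ℝ) * (c₀ * r * (c₀ * (1 / 4) ^ K) ^ (d + 2) / (d + 1) * τ ^ K) := by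
          gcongr
      _ = ε := by rw [hε]; field_simp
  linarith

/-- Almost every point of the curve `x ↦ (cₗ x ^ eₗ)` with distinct exponents is not very well
approximable. -/
theorem ae_not_veryWellApproximable_curve {d : ℕ} {e : Fin (d + 1) → ℕ}
    (he : Function.Injective e) {c : Fin (d + 1) → ℝ} (hc : ∀ l, c l ≠ 0) {ε : ℝ} (hε : 0 < ε) :
    ∀ᵐ x : ℝ, x ∈ Set.Ico (1 : ℝ) (1 + 1) → ∃ κ : ℝ, 0 < κ ∧ ∀ H : ℝ, 1 ≤ H →
      ∀ u : Fin (d + 1) → ℤ, u ≠ 0 → (∀ l, |(u l : ℝ)| ≤ H) →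
        κ / H ^ ((d : ℝ) + ε) < |∑ l, c l * x ^ e l * u l| := by
  obtain ⟨C, hC, K, hK, hmain⟩ := exists_volume_short_vector_le he hc
  set η : ℝ := ε / (d + 1) with hη
  have hη0 : 0 < η := by positivity
  have hηε : d * η - ε = -η := by rw [hη]; field_simp; ring
  set D : ℝ := max 1 (2 / C) with hD
  have hD1 : 1 ≤ D := le_max_left _ _
  have hCD : 1 < C * D ^ K := by
    have h1 : 2 / C ≤ D := le_max_right _ _
    have h2 : D ≤ D ^ K := le_self_pow₀ hD1 (by omega)
    rw [div_le_iff₀ hC] at h1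
    nlinarith
  let bad : ℕ → Set ℝ := fun i => {x ∈ Set.Ico (1 : ℝ) (1 + 1) | ∃ u : Fin (d + 1) → ℤ, u ≠ 0 ∧
    (∀ l, |(u l : ℝ)| ≤ 2 ^ i) ∧
      |∑ l, c l * x ^ e l * u l| ≤ ((2 : ℝ) ^ i) ^ (-((d : ℝ) + ε))}
  set q : ℝ := (2 : ℝ) ^ (-(η / K)) with hq
  have hq0 : 0 < q := by positivity
  have hKpos : (0 : ℝ) < K := by exact_mod_cast hK
  have hq1 : q < 1 := Real.rpow_lt_one_of_one_lt_of_neg (by norm_num)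
    (neg_neg_of_pos (by positivity))
  have hbad : ∀ i, volume (bad i) ≤ ENNReal.ofReal ((d + 2) * (D * q ^ i)) := by
    intro i
    rcases le_or_gt (D * q ^ i) 1 with hτ1 | hτ1
    · set N : ℝ := 2 ^ i with hN
      have hN1 : 1 ≤ N := one_le_pow₀ (by norm_num)
      have hN0 : 0 < N := by positivity
      have hqK : (q ^ i) ^ K = N ^ (-η) := by
        rw [hq, hN, ← Real.rpow_natCast _ i, ← Real.rpow_natCast 2 i, ← Real.rpow_natCast _ K,
          ← Real.rpow_mul (by positivity), ← Real.rpow_mul (by positivity),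
          ← Real.rpow_mul (by positivity)]
        congr 1
        field_simp
      refine le_trans (measure_mono ?_) (hmain (N ^ (d * (1 + η))) (N ^ (-(1 + η))) (by positivity)
        (Real.rpow_le_one_of_one_le_of_nonpos hN1 (by linarith)) (le_of_eq ?_) _ (by positivity) hτ1)
      · rintro x ⟨hx, u, hu, huN, hsum⟩
        refine ⟨hx, u, hu, ?_⟩
        have hlt : N ^ (-η) < C * (D * q ^ i) ^ K := by
          rw [mul_pow, hqK, ← mul_assoc]
          exact lt_mul_of_one_lt_left (by positivity) hCD
        refine lt_of_le_of_lt ((pi_norm_le_iff_of_nonneg (by positivity)).mpr fun l => ?_) hlt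
        by_cases hl : l = 0
        · subst hl
          have h1 : (flowMatrix e c (N ^ (d * (1 + η))) (N ^ (-(1 + η))) x).mulVec
              (fun a => (u a : ℝ)) 0 = N ^ (d * (1 + η)) * ∑ l, c l * x ^ e l * u l := by
            simp [Matrix.mulVec, dotProduct, flowMatrix, Finset.mul_sum, mul_assoc]
          rw [h1, norm_mul, Real.norm_eq_abs, Real.norm_eq_abs, abs_of_pos (by positivity)]
          calc _ ≤ N ^ (d * (1 + η)) * N ^ (-((d : ℝ) + ε)) := by gcongr
            _ = N ^ (-η) := by
              rw [← Real.rpow_add hN0]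
              congr 1
              linarith
        · have h1 : (flowMatrix e c (N ^ (d * (1 + η))) (N ^ (-(1 + η))) x).mulVec
              (fun a => (u a : ℝ)) l = N ^ (-(1 + η)) * u l := by
            simp [Matrix.mulVec, dotProduct, flowMatrix, hl]
          rw [h1, norm_mul, Real.norm_eq_abs, Real.norm_eq_abs, abs_of_pos (by positivity)]
          calc _ ≤ N ^ (-(1 + η)) * N ^ (1 : ℝ) := by
                rw [Real.rpow_one]
                gcongr
                exact huN l
            _ = N ^ (-η) := by
              rw [← Real.rpow_add hN0]
              congr 1
              ring
      · rw [← Real.rpow_natCast _ d, ← Real.rpow_mul hN0.le, ← Real.rpow_add hN0]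
        ring_nf
        rw [Real.rpow_zero]
    · refine (measure_mono (fun x hx => hx.1 : bad i ⊆ Set.Ico 1 (1 + 1))).trans ?_
      rw [Real.volume_Ico]
      refine ENNReal.ofReal_le_ofReal ?_
      have : (0 : ℝ) ≤ d := by positivity
      nlinarith
  have hsum : ∑' i, volume (bad i) ≠ ⊤ := by
    refine ne_top_of_le_ne_top ?_ (ENNReal.tsum_le_tsum hbad)
    exact Summable.tsum_ofReal_ne_top
      (((summable_geometric_of_lt_one hq0.le hq1).mul_left D).mul_left _)
  filter_upwards [ae_eventually_notMem hsum] with x hx hxI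
  obtain ⟨i₀, hi₀⟩ := Filter.eventually_atTop.mp hx
  have hdε : 0 ≤ (d : ℝ) + ε := by positivity
  refine ⟨((2 : ℝ) ^ (i₀ + 1)) ^ (-((d : ℝ) + ε)), by positivity, fun H hH u hu huH => ?_⟩
  obtain ⟨j, hj1, hj2⟩ := exists_nat_pow_near hH (one_lt_two (α := ℝ))
  have hnot := hi₀ (i₀ + (j + 1)) (by omega)
  have hlow : ((2 : ℝ) ^ (i₀ + (j + 1))) ^ (-((d : ℝ) + ε)) < |∑ l, c l * x ^ e l * u l| := by
    by_contra! hle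
    refine hnot ⟨hxI, u, hu, fun l => (huH l).trans (hj2.le.trans ?_), hle⟩
    exact pow_le_pow_right₀ (by norm_num) (by omega)
  refine lt_of_le_of_lt ?_ hlow
  have hH0 : 0 < H := by linarith
  rw [div_eq_mul_inv, ← Real.rpow_neg hH0.le, ← Real.mul_rpow (by positivity) hH0.le]
  refine Real.rpow_le_rpow_of_nonpos (by positivity) ?_ (by linarith)
  calc (2 : ℝ) ^ (i₀ + (j + 1)) = 2 ^ (i₀ + 1) * 2 ^ j := by ring
    _ ≤ _ := by gcongr


/-- A measurable set of `ℝⁿ` meeting almost every curve `t ↦ (cᵢ t ^ aᵢ)` in almost every parameter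
of `[1, 2)` is of full measure. -/
theorem ae_mem_of_forall_curve {n : ℕ} {G : Set (Fin n → ℝ)} (hG : MeasurableSet G)
    (a : Fin n → ℕ)
    (hcurve : ∀ c : Fin n → ℝ, (∀ i, c i ≠ 0) →
      ∀ᵐ t : ℝ, t ∈ Set.Ico (1 : ℝ) (1 + 1) → (fun i => c i * t ^ a i) ∈ G) :
    ∀ᵐ h : Fin n → ℝ, h ∈ G := by
  have hne : ∀ᵐ c : Fin n → ℝ, ∀ i, c i ≠ 0 := by
    rw [ae_all_iff]
    intro i
    rw [volume_pi]
    exact Measure.ae_eval_ne _ i 0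
  have h1 : ∀ᵐ c : Fin n → ℝ, ∀ᵐ t : ℝ, t ∈ Set.Ico (1 : ℝ) (1 + 1) →
      (fun i => c i * t ^ a i) ∈ G := hne.mono hcurve
  have hmeas : MeasurableSet {x : (Fin n → ℝ) × ℝ |
      x.2 ∈ Set.Ico (1 : ℝ) (1 + 1) → (fun i => x.1 i * x.2 ^ a i) ∈ G} := by
    have hf : Measurable fun x : (Fin n → ℝ) × ℝ => fun i => x.1 i * x.2 ^ a i := by fun_prop
    exact (measurable_snd measurableSet_Ico).imp (hf hG)
  rw [Measure.ae_ae_comm hmeas] at h1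
  obtain ⟨t, ht, htG⟩ : ∃ t ∈ Set.Ico (1 : ℝ) (1 + 1),
      ∀ᵐ c : Fin n → ℝ, (fun i => c i * t ^ a i) ∈ G := by
    by_contra! hcon
    have h2 : ∀ᵐ t : ℝ, t ∉ Set.Ico (1 : ℝ) (1 + 1) := by
      filter_upwards [h1] with t ht hmem
      exact hcon t hmem (by filter_upwards [ht] with c hc using not_not_intro (hc hmem))
    have h3 := measure_eq_zero_iff_ae_notMem.mpr h2
    norm_num [Real.volume_Ico] at h3
  have ht0 : t ≠ 0 := by
    have := ht.1
    positivity
  have hdet : LinearMap.det (Matrix.toLin' (Matrix.diagonal fun i => (t ^ a i)⁻¹)) ≠ 0 := by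
    rw [LinearMap.det_toLin', Matrix.det_diagonal]
    exact Finset.prod_ne_zero_iff.mpr fun i _ => inv_ne_zero (pow_ne_zero _ ht0)
  filter_upwards [(Measure.LinearMap.quasiMeasurePreserving volume _ hdet).ae htG] with h hh
  convert hh using 1
  ext i
  rw [Matrix.toLin'_apply, Matrix.mulVec_diagonal]
  field_simp

/-- Finite families of natural numbers are distinguished by their digits in a large base. -/
theorem exists_injective_sum_mul_pow {ι : Type*} [Finite ι] {n : ℕ} {w : ι → Fin n → ℕ}
    (hw : Function.Injective w) :
    ∃ B : ℕ, Function.Injective fun l => ∑ i, w l i * B ^ (i : ℕ) := by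
  obtain ⟨B, hB⟩ := Set.Finite.bddAbove (Set.finite_range fun p : ι × Fin n => w p.1 p.2)
  have hlt : ∀ l i, w l i < B + 1 := fun l i => Nat.lt_succ_of_le (hB ⟨(l, i), rfl⟩)
  refine ⟨B + 1, fun l l' hll => hw ?_⟩
  have h1 : finFunctionFinEquiv (fun i => (⟨w l i, hlt l i⟩ : Fin (B + 1))) =
      finFunctionFinEquiv (fun i => (⟨w l' i, hlt l' i⟩ : Fin (B + 1))) := by
    ext
    simpa [finFunctionFinEquiv_apply] using hll
  ext i
  exact congrArg Fin.val (congrFun (finFunctionFinEquiv.injective h1) i)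

/-- Almost every point of `ℝⁿ` is not very well approximable by values of integer linear forms in
finitely many distinct monomials. -/
theorem ae_not_veryWellApproximable_monomials {n d : ℕ} {w : Fin (d + 1) → Fin n → ℕ}
    (hw : Function.Injective w) {ε : ℝ} (hε : 0 < ε) :
    ∀ᵐ h : Fin n → ℝ, ∃ κ : ℝ, 0 < κ ∧ ∀ H : ℕ, 1 ≤ H →
      ∀ u : Fin (d + 1) → ℤ, u ≠ 0 → (∀ l, |(u l : ℝ)| ≤ H) →
        κ / (H : ℝ) ^ ((d : ℝ) + ε) < |∑ l, (∏ i, h i ^ w l i) * (u l : ℝ)| := by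
  let G : Set (Fin n → ℝ) := {h | ∃ k : ℕ, ∀ H : ℕ, 1 ≤ H →
      ∀ u : Fin (d + 1) → ℤ, u ≠ 0 → (∀ l, |(u l : ℝ)| ≤ H) →
        1 / ((k : ℝ) + 1) / (H : ℝ) ^ ((d : ℝ) + ε) < |∑ l, (∏ i, h i ^ w l i) * (u l : ℝ)|}
  have hG : MeasurableSet G := by
    simp only [G, Set.ofPred_exists, Set.ofPred_forall]
    refine MeasurableSet.iUnion fun k => MeasurableSet.iInter fun H => MeasurableSet.iInter fun _ =>
      MeasurableSet.iInter fun u => MeasurableSet.iInter fun _ => MeasurableSet.iInter fun _ =>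
        measurableSet_lt (by fun_prop) ?_
    exact Continuous.measurable (by fun_prop)
  obtain ⟨B, hB⟩ := exists_injective_sum_mul_pow hw
  have key : ∀ᵐ h : Fin n → ℝ, h ∈ G := by
    refine ae_mem_of_forall_curve hG (fun i => B ^ (i : ℕ)) fun c hc => ?_
    have hc' : ∀ l, ∏ i, c i ^ w l i ≠ 0 := fun l =>
      Finset.prod_ne_zero_iff.mpr fun i _ => pow_ne_zero _ (hc i)
    filter_upwards [ae_not_veryWellApproximable_curve hB hc' hε] with t ht htI
    obtain ⟨κ, hκ, hκu⟩ := ht htI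
    obtain ⟨k, hk⟩ := exists_nat_one_div_lt hκ
    refine ⟨k, fun H hH u hu huH => lt_of_le_of_lt ?_
      (lt_of_lt_of_eq (hκu H (by exact_mod_cast hH) u hu huH) ?_)⟩
    · gcongr
    · congr 1
      refine Finset.sum_congr rfl fun l _ => ?_
      rw [← Finset.prod_pow_eq_pow_sum, ← Finset.prod_mul_distrib]
      congr 1
      refine Finset.prod_congr rfl fun i _ => ?_
      rw [mul_pow, ← pow_mul, mul_comm (w l i)]
  filter_upwards [key] with h hh
  obtain ⟨k, hk⟩ := hh
  exact ⟨1 / ((k : ℝ) + 1), by positivity, hk⟩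

/-- Minimum-distance bound for the received constellation: if the `m - 1`
directions are pairwise distinct non-constant monomials in the channel gains
`h ∈ ℝ^n`, then for almost every `h` there is `κ > 0` such that any two
distinct points of the constellation
`{A (u₀ + ∑ gₗ(h) uₗ) : uₗ ∈ ℤ, |uₗ| ≤ fQ}` are at distance greater than
`κ A / (2fQ)^(m-1+ε)`. -/
theorem received_constellation_min_dist (n m : ℕ) (hn : 1 ≤ n) (hm : 2 ≤ m)
    (ε : ℝ) (hε : 0 < ε)
    (s : Fin (m - 1) → Fin n → ℕ) (hs : Function.Injective s)
    (hs0 : ∀ l, s l ≠ 0) :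
    ∀ᵐ h : Fin n → ℝ, ∃ κ : ℝ, 0 < κ ∧
      ∀ A : ℝ, 0 < A → ∀ f Q : ℕ, 1 ≤ f → 1 ≤ Q →
        ∀ (u₀ u₀' : ℤ) (u u' : Fin (m - 1) → ℤ),
          |u₀| ≤ ((f * Q : ℕ) : ℤ) → |u₀'| ≤ ((f * Q : ℕ) : ℤ) →
          (∀ l, |u l| ≤ ((f * Q : ℕ) : ℤ)) → (∀ l, |u' l| ≤ ((f * Q : ℕ) : ℤ)) →
          A * ((u₀ : ℝ) + ∑ l, (∏ i, h i ^ s l i) * (u l : ℝ)) ≠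
            A * ((u₀' : ℝ) + ∑ l, (∏ i, h i ^ s l i) * (u' l : ℝ)) →
          κ * A / ((2 * f * Q : ℕ) : ℝ) ^ ((m : ℝ) - 1 + ε) <
            |A * ((u₀ : ℝ) + ∑ l, (∏ i, h i ^ s l i) * (u l : ℝ)) -
              A * ((u₀' : ℝ) + ∑ l, (∏ i, h i ^ s l i) * (u' l : ℝ))| := by
  have hw : Function.Injective (Fin.cons 0 s : Fin (m - 1 + 1) → Fin n → ℕ) :=
    Fin.cons_injective_iff.mpr ⟨fun ⟨l, hl⟩ => hs0 l hl, hs⟩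
  filter_upwards [ae_not_veryWellApproximable_monomials hw hε] with h ⟨κ, hκ, hκu⟩
  refine ⟨κ, hκ, fun A hA f Q hf hQ u₀ u₀' u u' hu₀ hu₀' hu hu' hne => ?_⟩
  have hbound : ∀ a b : ℤ, |a| ≤ ((f * Q : ℕ) : ℤ) → |b| ≤ ((f * Q : ℕ) : ℤ) →
      |((a - b : ℤ) : ℝ)| ≤ ((2 * f * Q : ℕ) : ℝ) := by
    intro a b ha hb
    have hab : |a - b| ≤ ((2 * f * Q : ℕ) : ℤ) := by
      have := abs_sub a b
      push_cast at *
      linarith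
    exact_mod_cast hab
  let v : Fin (m - 1 + 1) → ℤ := Fin.cons (u₀ - u₀') (fun l => u l - u' l)
  have hv : ∑ l, (∏ i, h i ^ (Fin.cons 0 s : Fin (m - 1 + 1) → Fin n → ℕ) l i) * (v l : ℝ) =
      ((u₀ : ℝ) + ∑ l, (∏ i, h i ^ s l i) * (u l : ℝ)) -
        ((u₀' : ℝ) + ∑ l, (∏ i, h i ^ s l i) * (u' l : ℝ)) := by
    simp only [v, Fin.sum_univ_succ, Fin.cons_zero, Fin.cons_succ, Pi.zero_apply, pow_zero,
      Finset.prod_const_one, one_mul, Int.cast_sub, mul_sub, Finset.sum_sub_distrib]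
    ring
  have hv0 : v ≠ 0 := by
    intro hv0
    rw [hv0] at hv
    simp only [Pi.zero_apply, Int.cast_zero, mul_zero, Finset.sum_const_zero] at hv
    exact hne (by rw [sub_eq_zero.mp hv.symm])
  have hmain := hκu (2 * f * Q) (Nat.mul_pos (by omega) hQ) v hv0
    (Fin.cases (hbound _ _ hu₀ hu₀') fun l => hbound _ _ (hu l) (hu' l))
  rw [hv, Nat.cast_sub (by omega : 1 ≤ m), Nat.cast_one] at hmain
  rw [← mul_sub, abs_mul, abs_of_pos hA, mul_comm κ, mul_div_assoc]
  exact mul_lt_mul_of_pos_left hmain hA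
end

section
/- Fix ε > 0. For Lebesgue-almost every (h₁₁, h₁₂, h₂₁, h₂₂) ∈ ℝ⁴ there exists a constant κ > 0 such that for all integers u₁, u₂, u₃, not all zero, |u₁·(h₁₁h₂₂) + u₂·(h₁₂h₂₁) + u₃·(h₁₁h₁₂)| ≥ κ / (max{|u₁|,|u₂|,|u₃|})^{2+ε}. -/
open MeasureTheory

lemma UnitAddCircle.quasiMeasurePreserving_coe :
    Measure.QuasiMeasurePreserving ((↑) : ℝ → UnitAddCircle) := by
  refine ⟨AddCircle.measurable_mk', Measure.AbsolutelyContinuous.mk fun s hs h0 => ?_⟩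
  rw [Measure.map_apply AddCircle.measurable_mk' hs]
  have hcover : ((↑) : ℝ → UnitAddCircle) ⁻¹' s =
      ⋃ n : ℤ, ((↑) : ℝ → UnitAddCircle) ⁻¹' s ∩ Set.Ioc (n : ℝ) (n + 1) := by
    rw [← Set.inter_iUnion, iUnion_Ioc_intCast, Set.inter_univ]
  rw [hcover, measure_iUnion_null_iff]
  intro n
  rw [← h0]
  exact (AddCircle.add_projection_respects_measure (T := 1) (n : ℝ) hs).symm

lemma UnitAddCircle.quasiMeasurePreserving_coe_div {c : ℝ} (hc : c ≠ 0) :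
    Measure.QuasiMeasurePreserving (fun x : ℝ => ((x / c : ℝ) : UnitAddCircle)) := by
  refine UnitAddCircle.quasiMeasurePreserving_coe.comp ⟨by fun_prop, ?_⟩
  simp_rw [div_eq_mul_inv]
  rw [Real.map_volume_mul_right (inv_ne_zero hc)]
  exact Measure.smul_absolutelyContinuous

lemma UnitAddCircle.measurePreserving_zsmul_add_zsmul {u : Fin 2 → ℤ} (hu : u ≠ 0) :
    MeasurePreserving
      (fun p : UnitAddCircle × UnitAddCircle => u 0 • p.1 + u 1 • p.2) := by
  let f : UnitAddCircle × UnitAddCircle →+ UnitAddCircle :=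
    (zsmulAddGroupHom (u 0)).coprod (zsmulAddGroupHom (u 1))
  have hcont : Continuous f := by
    change Continuous fun p : UnitAddCircle × UnitAddCircle => u 0 • p.1 + u 1 • p.2
    fun_prop
  have hsurj : Function.Surjective f := by
    intro y
    by_cases h0 : u 0 = 0
    · have h1 : u 1 ≠ 0 := fun h1 => hu (by ext i; fin_cases i <;> simp [h0, h1])
      obtain ⟨x, hx⟩ := DivisibleBy.surjective_smul UnitAddCircle ℤ h1 y
      exact ⟨(0, x), by simpa [f] using hx⟩
    · obtain ⟨x, hx⟩ := DivisibleBy.surjective_smul UnitAddCircle ℤ h0 y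
      exact ⟨(x, 0), by simpa [f] using hx⟩
  have : (volume : Measure (UnitAddCircle × UnitAddCircle)).IsAddHaarMeasure :=
    Measure.prod.instIsAddHaarMeasure _ _
  refine AddMonoidHom.measurePreserving (f := f) hcont hsurj ?_
  rw [← Set.univ_prod_univ, Measure.volume_eq_prod, Measure.prod_prod]
  simp

lemma UnitAddCircle.volume_norm_zsmul_add_zsmul_le {u : Fin 2 → ℤ} (hu : u ≠ 0) (δ : ℝ) :
    volume {p : UnitAddCircle × UnitAddCircle | ‖u 0 • p.1 + u 1 • p.2‖ ≤ δ} ≤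
      ENNReal.ofReal (2 * δ) := by
  have h := (UnitAddCircle.measurePreserving_zsmul_add_zsmul hu).measure_preimage
    (Metric.isClosed_closedBall (x := (0 : UnitAddCircle)) (ε := δ)).nullMeasurableSet
  rw [AddCircle.volume_closedBall] at h
  have hset : {p : UnitAddCircle × UnitAddCircle | ‖u 0 • p.1 + u 1 • p.2‖ ≤ δ} =
      (fun p : UnitAddCircle × UnitAddCircle => u 0 • p.1 + u 1 • p.2) ⁻¹'
        Metric.closedBall 0 δ := by
    ext p; simp
  rw [hset, h]
  exact ENNReal.ofReal_le_ofReal (min_le_right _ _)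

lemma Set.Finite.exists_pos_forall_le {ι : Type*} {s : Set ι} (hs : s.Finite) (f : ι → ℝ)
    (hf : ∀ i ∈ s, 0 < f i) : ∃ κ : ℝ, 0 < κ ∧ κ ≤ 1 ∧ ∀ i ∈ s, κ ≤ f i := by
  induction s, hs using Set.Finite.induction_on with
  | empty => exact ⟨1, one_pos, le_rfl, by simp⟩
  | @insert a s _ _ ih =>
    obtain ⟨κ, hκ, hκ1, h⟩ := ih fun i hi => hf i (Set.mem_insert_of_mem _ hi)
    refine ⟨min κ (f a), lt_min hκ (hf a (Set.mem_insert _ _)), (min_le_left _ _).trans hκ1, ?_⟩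
    rintro i (rfl | hi)
    · exact min_le_right _ _
    · exact (min_le_left _ _).trans (h i hi)

/-- The convergence part of the **Khintchine–Groshev theorem** for linear forms in two variables. -/
lemma UnitAddCircle.ae_exists_forall_le_norm_zsmul_add_zsmul {r : ℝ} (hr : 2 < r) :
    ∀ᵐ p : UnitAddCircle × UnitAddCircle, ∃ κ : ℝ, 0 < κ ∧ κ ≤ 1 ∧
      ∀ u : Fin 2 → ℤ, u ≠ 0 → κ * ‖u‖ ^ (-r) ≤ ‖u 0 • p.1 + u 1 • p.2‖ := by
  let s : (Fin 2 → ℤ) → Set (UnitAddCircle × UnitAddCircle) := fun u =>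
    {p | u ≠ 0 ∧ ‖u 0 • p.1 + u 1 • p.2‖ ≤ ‖u‖ ^ (-r)}
  have hs : ∑' u, volume (s u) ≠ ⊤ := by
    have hsum : Summable fun u : Fin 2 → ℤ => 2 * ‖u‖ ^ (-r) :=
      (EisensteinSeries.summable_one_div_norm_rpow hr).mul_left 2
    refine ne_top_of_le_ne_top hsum.tsum_ofReal_ne_top (ENNReal.tsum_le_tsum fun u => ?_)
    by_cases hu : u = 0
    · simp [s, hu]
    · exact (measure_mono fun p hp => hp.2).trans
        (UnitAddCircle.volume_norm_zsmul_add_zsmul_le hu _)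
  have hne : ∀ᵐ p : UnitAddCircle × UnitAddCircle, ∀ u : Fin 2 → ℤ, u ≠ 0 →
      0 < ‖u 0 • p.1 + u 1 • p.2‖ := by
    refine ae_all_iff.2 fun u => ?_
    by_cases hu : u = 0
    · simp [hu]
    · have h := UnitAddCircle.volume_norm_zsmul_add_zsmul_le hu 0
      rw [mul_zero, ENNReal.ofReal_zero, nonpos_iff_eq_zero] at h
      filter_upwards [measure_eq_zero_iff_ae_notMem.1 h] with p hp _
      exact not_le.1 hp
  filter_upwards [ae_finite_setOfPred_mem hs, hne] with p hfin hpos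
  obtain ⟨κ, hκ, hκ1, h⟩ := hfin.exists_pos_forall_le
    (fun u => ‖u 0 • p.1 + u 1 • p.2‖ / ‖u‖ ^ (-r))
    fun u hu => div_pos (hpos u hu.1) (Real.rpow_pos_of_pos (norm_pos_iff.2 hu.1) _)
  refine ⟨κ, hκ, hκ1, fun u hu => ?_⟩
  have hu' : 0 < ‖u‖ ^ (-r) := Real.rpow_pos_of_pos (norm_pos_iff.2 hu) _
  by_cases hmem : p ∈ s u
  · exact (le_div_iff₀ hu').1 (h u hmem)
  · have : ‖u‖ ^ (-r) < ‖u 0 • p.1 + u 1 • p.2‖ := not_le.1 fun hle => hmem ⟨hu, hle⟩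
    nlinarith

lemma quasiMeasurePreserving_coe_div_row :
    Measure.QuasiMeasurePreserving (fun h : Fin 2 → Fin 2 → ℝ =>
      (((h 1 0 / h 0 0 : ℝ) : UnitAddCircle), ((h 1 1 / h 0 1 : ℝ) : UnitAddCircle))) := by
  let f : (Fin 2 → ℝ) × (Fin 2 → ℝ) → UnitAddCircle × UnitAddCircle := fun v =>
    (((v.2 0 / v.1 0 : ℝ) : UnitAddCircle), ((v.2 1 / v.1 1 : ℝ) : UnitAddCircle))
  have hmeas : Measurable f :=
    (AddCircle.measurable_mk'.comp (by fun_prop)).prodMk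
      (AddCircle.measurable_mk'.comp (by fun_prop))
  have hne : ∀ i : Fin 2, ∀ᵐ v : Fin 2 → ℝ, v i ≠ 0 := fun i =>
    (Measure.quasiMeasurePreserving_eval (fun _ : Fin 2 => (volume : Measure ℝ)) i).ae
      (Measure.ae_ne volume 0)
  have hf : Measure.QuasiMeasurePreserving f (volume.prod volume) volume := by
    refine QuasiMeasurePreserving.prod_of_right hmeas ?_
    filter_upwards [hne 0, hne 1] with v h0 h1
    exact (QuasiMeasurePreserving.prodMap
      (UnitAddCircle.quasiMeasurePreserving_coe_div h0)
      (UnitAddCircle.quasiMeasurePreserving_coe_div h1)).comp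
        (volume_preserving_finTwoArrow ℝ).quasiMeasurePreserving
  exact hf.comp (volume_preserving_finTwoArrow (Fin 2 → ℝ)).quasiMeasurePreserving

lemma quasiMeasurePreserving_eval_eval (i j : Fin 2) :
    Measure.QuasiMeasurePreserving (fun h : Fin 2 → Fin 2 → ℝ => h i j) :=
  (Measure.quasiMeasurePreserving_eval (fun _ : Fin 2 => (volume : Measure ℝ)) j).comp
    (Measure.quasiMeasurePreserving_eval (fun _ : Fin 2 => (volume : Measure (Fin 2 → ℝ))) i)

/-- Khintchine–Groshev bound for the two-user X channel: for almost every
channel matrix `(h_{ji})` there is `κ > 0` such that for all integers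
`u₁, u₂, u₃`, not all zero,
`|u₁ h₁₁h₂₂ + u₂ h₁₂h₂₁ + u₃ h₁₁h₁₂| ≥ κ / (max |uᵢ|)^(2+ε)`.
Here `h j i` is the gain from transmitter `i` to receiver `j`
(indices `0, 1` for `1, 2`). -/
theorem two_user_X_channel_min_dist (ε : ℝ) (hε : 0 < ε) :
    ∀ᵐ h : Fin 2 → Fin 2 → ℝ, ∃ κ : ℝ, 0 < κ ∧
      ∀ u₁ u₂ u₃ : ℤ, ¬(u₁ = 0 ∧ u₂ = 0 ∧ u₃ = 0) →
        κ / (((max (max |u₁| |u₂|) |u₃| : ℤ)) : ℝ) ^ ((2 : ℝ) + ε) ≤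
          |(u₁ : ℝ) * (h 0 0 * h 1 1) + (u₂ : ℝ) * (h 0 1 * h 1 0) +
            (u₃ : ℝ) * (h 0 0 * h 0 1)| := by
  filter_upwards [quasiMeasurePreserving_coe_div_row.ae
      (UnitAddCircle.ae_exists_forall_le_norm_zsmul_add_zsmul (r := 2 + ε) (by linarith)),
    (quasiMeasurePreserving_eval_eval 0 0).ae (Measure.ae_ne volume 0),
    (quasiMeasurePreserving_eval_eval 0 1).ae (Measure.ae_ne volume 0)]
    with h ⟨κ, hκ, hκ1, hle⟩ h0 h1
  have hc : 0 < |h 0 0 * h 0 1| := abs_pos.2 (mul_ne_zero h0 h1)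
  refine ⟨κ * |h 0 0 * h 0 1|, by positivity, fun u₁ u₂ u₃ hu => ?_⟩
  set M : ℤ := max (max |u₁| |u₂|) |u₃| with hM
  have hM1 : |u₁| ≤ M := by simp [hM]
  have hM2 : |u₂| ≤ M := by simp [hM]
  have hM3 : |u₃| ≤ M := by simp [hM]
  have hMpos : 1 ≤ M := by
    by_contra hlt
    refine hu ⟨?_, ?_, ?_⟩ <;> refine abs_nonpos_iff.1 ?_ <;> omega
  have hMpos' : (1 : ℝ) ≤ M := by exact_mod_cast hMpos
  have hform : (u₁ : ℝ) * (h 0 0 * h 1 1) + u₂ * (h 0 1 * h 1 0) + u₃ * (h 0 0 * h 0 1) =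
      (u₂ * (h 1 0 / h 0 0) + u₁ * (h 1 1 / h 0 1) + u₃) * (h 0 0 * h 0 1) := by
    field_simp
    ring
  rw [hform, abs_mul _ (h 0 0 * h 0 1), mul_div_right_comm]
  refine mul_le_mul_of_nonneg_right ?_ hc.le
  rw [div_eq_mul_inv, ← Real.rpow_neg (by positivity)]
  by_cases hz : ![u₂, u₁] = 0
  · have h2 : u₂ = 0 := congrFun hz 0
    have h1 : u₁ = 0 := congrFun hz 1
    have h3 : (1 : ℝ) ≤ |(u₃ : ℝ)| := by
      exact_mod_cast Int.one_le_abs fun h3 => hu ⟨h1, h2, h3⟩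
    have hpow : (M : ℝ) ^ (-(2 + ε)) ≤ 1 :=
      Real.rpow_le_one_of_one_le_of_nonpos hMpos' (by linarith)
    simp only [h1, h2, Int.cast_zero, zero_mul, zero_add]
    exact (mul_le_one₀ hκ1 (by positivity) hpow).trans h3
  · have hnorm : ‖![u₂, u₁]‖ ≤ M := by
      refine (pi_norm_le_iff_of_nonneg (by positivity)).2 fun i => ?_
      rw [Int.norm_eq_abs, ← Int.cast_abs]
      fin_cases i
      · exact_mod_cast hM2
      · exact_mod_cast hM1
    calc κ * (M : ℝ) ^ (-(2 + ε)) ≤ κ * ‖![u₂, u₁]‖ ^ (-(2 + ε)) := by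
          gcongr ?_ * ?_
          exact Real.rpow_le_rpow_of_nonpos (norm_pos_iff.2 hz) hnorm (by linarith)
      _ ≤ _ := hle _ hz
      _ = ‖((u₂ * (h 1 0 / h 0 0) + u₁ * (h 1 1 / h 0 1) + u₃ : ℝ) : UnitAddCircle)‖ := by
          have h3 : ((u₃ : ℝ) : UnitAddCircle) = 0 :=
            (AddCircle.coe_eq_zero_iff 1).2 ⟨u₃, by simp⟩
          simp only [← zsmul_eq_mul, AddCircle.coe_add, AddCircle.coe_zsmul, h3, add_zero,
            Matrix.cons_val_zero, Matrix.cons_val_one]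
      _ ≤ _ := QuotientAddGroup.norm_mk_le_norm
end

section
/- Let K ≥ 2 and n ≥ 1 be integers, and let (h_{jl})_{1≤j,l≤K} be real numbers that are algebraically independent over ℚ. For i ∈ {1,…,K}, let T_i be the set of monomials ∏_{j≠l} h_{jl}^{s_{jl}} with 0 ≤ s_{ji} ≤ n−1 for all j ≠ i and 0 ≤ s_{jl} ≤ n for all other off-diagonal pairs, and let T_r be the set of monomials ∏_{j≠l} h_{jl}^{s_{jl}} with 0 ≤ s_{jl} ≤ n for all off-diagonal pairs. Then: (a) for every k ≠ i, every element of h_{ik}·T_k (the set T_k with each element multiplied by h_{ik}) belongs to T_r; (b) the cardinality of T_r equals (n+1)^{K(K−1)}; and (c) the sets h_{ii}·T_i and T_r are disjoint. -/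
/-- The set `T_k` of transmit directions of user `k`: monomials in the channel
gains with zero diagonal exponents, exponents of column `k` at most `n-1`,
and all other off-diagonal exponents at most `n`. -/
def transmitDirs (K n : ℕ) (h : Fin K → Fin K → ℝ) (k : Fin K) : Set ℝ :=
  {x | ∃ s : Fin K → Fin K → ℕ,
    (∀ j, s j j = 0) ∧ (∀ j, j ≠ k → s j k ≤ n - 1) ∧
    (∀ j l, j ≠ l → l ≠ k → s j l ≤ n) ∧ x = ∏ j, ∏ l, h j l ^ s j l}

/-- The set `T_r` of received interference directions: monomials in the channel
gains with zero diagonal exponents and all off-diagonal exponents at most `n`. -/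
def recvDirs (K n : ℕ) (h : Fin K → Fin K → ℝ) : Set ℝ :=
  {x | ∃ s : Fin K → Fin K → ℕ,
    (∀ j, s j j = 0) ∧ (∀ j l, s j l ≤ n) ∧ x = ∏ j, ∏ l, h j l ^ s j l}

/-- Monomials with distinct exponents in algebraically independent gains are distinct. -/
theorem gainMonomial_injective {ι : Type*} [Fintype ι] {h : ι → ι → ℝ}
    (halg : AlgebraicIndependent ℚ (fun p : ι × ι => h p.1 p.2)) :
    Function.Injective (fun s : ι → ι → ℕ => ∏ j, ∏ l, h j l ^ s j l) := by
  have key (s : ι → ι → ℕ) : ∏ j, ∏ l, h j l ^ s j l =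
      MvPolynomial.aeval (fun p : ι × ι => h p.1 p.2)
        (MvPolynomial.monomial (Finsupp.equivFunOnFinite.symm (Function.uncurry s)) (1 : ℚ)) := by
    rw [MvPolynomial.aeval_monomial, Finsupp.prod_fintype _ _ (fun _ => pow_zero _),
      Fintype.prod_prod_type]
    simp
  intro s t hst
  simp only [key] at hst
  have hexp := MvPolynomial.monomial_left_injective one_ne_zero (halg hst)
  exact Function.uncurry_injective (Finsupp.equivFunOnFinite.symm.injective hexp)

/-- Multiplying a monomial by the gain `h a b` raises the exponent at `(a, b)` by one. -/
theorem gain_mul_gainMonomial {ι : Type*} [Fintype ι] [DecidableEq ι] (h : ι → ι → ℝ)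
    (s : ι → ι → ℕ) (a b : ι) :
    h a b * ∏ j, ∏ l, h j l ^ s j l =
      ∏ j, ∏ l, h j l ^ (s j l + if j = a ∧ l = b then 1 else 0) := by
  have single : ∏ j, ∏ l, h j l ^ (if j = a ∧ l = b then 1 else 0) = h a b := by
    rw [Fintype.prod_eq_single a, Fintype.prod_eq_single b] <;> simp +contextual
  simp_rw [pow_add, Finset.prod_mul_distrib]
  rw [single, mul_comm]

/-- The exponents of the monomials in `recvDirs`. -/
def recvExponents (K n : ℕ) : Finset (Fin K → Fin K → ℕ) :=
  Fintype.piFinset fun j => Fintype.piFinset fun l => if j = l then {0} else Finset.range (n + 1)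

theorem mem_recvExponents {K n : ℕ} {s : Fin K → Fin K → ℕ} :
    s ∈ recvExponents K n ↔ (∀ j, s j j = 0) ∧ ∀ j l, s j l ≤ n := by
  simp only [recvExponents, Fintype.mem_piFinset]
  constructor
  · intro hs
    have diag j : s j j = 0 := by simpa using hs j j
    refine ⟨diag, fun j l => ?_⟩
    by_cases hjl : j = l
    · subst hjl
      simp [diag]
    · simpa [hjl, Nat.lt_succ_iff] using hs j l
  · rintro ⟨diag, hs⟩ j l
    split_ifs with hjl
    · subst hjl
      simp [diag]
    · simpa [Nat.lt_succ_iff] using hs j l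

theorem card_recvExponents (K n : ℕ) :
    (recvExponents K n).card = (n + 1) ^ (K * (K - 1)) := by
  have row (j : Fin K) :
      ∏ l, (if j = l then ({0} : Finset ℕ) else Finset.range (n + 1)).card =
        (n + 1) ^ (K - 1) := by
    rw [← Finset.mul_prod_erase _ _ (Finset.mem_univ j)]
    rw [Finset.prod_congr rfl (g := fun _ => n + 1)
      (fun l hl => by simp [(Finset.ne_of_mem_erase hl).symm])]
    simp
  simp only [recvExponents, Fintype.card_piFinset, row]
  simp [← pow_mul, mul_comm]

theorem recvDirs_eq_image (K n : ℕ) (h : Fin K → Fin K → ℝ) :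
    recvDirs K n h = (fun s : Fin K → Fin K → ℕ => ∏ j, ∏ l, h j l ^ s j l) '' ↑(recvExponents K n) := by
  ext x
  simp [recvDirs, mem_recvExponents, and_assoc, eq_comm]


/-- Interference alignment in the `K`-user interference channel: with channel
gains algebraically independent over `ℚ`, (a) the directions of any
non-intended transmitter `k ≠ i` arrive at receiver `i` inside `T_r`,
(b) `T_r` has exactly `(n+1)^(K(K-1))` elements, and (c) the intended
directions `h i i • T_i` are disjoint from `T_r`. -/
theorem interference_alignment_K_user (K n : ℕ) (hK : 2 ≤ K) (hn : 1 ≤ n)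
    (h : Fin K → Fin K → ℝ)
    (halg : AlgebraicIndependent ℚ (fun p : Fin K × Fin K => h p.1 p.2))
    (i : Fin K) :
    (∀ k, k ≠ i → ∀ x ∈ transmitDirs K n h k, h i k * x ∈ recvDirs K n h) ∧
    Nat.card (recvDirs K n h) = (n + 1) ^ (K * (K - 1)) ∧
    Disjoint ((fun x => h i i * x) '' transmitDirs K n h i)
      (recvDirs K n h) := by
  refine ⟨?_, ?_, ?_⟩
  · rintro k hk x ⟨s, diag, hcol, hoff, rfl⟩
    refine ⟨_, fun j => ?_, fun j l => ?_, gain_mul_gainMonomial h s i k⟩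
    · rw [diag, if_neg (fun hj => hk (hj.2.symm.trans hj.1))]
    · have := diag j
      have := hcol j
      have := hoff j l
      grind
  · rw [recvDirs_eq_image, Nat.card_coe_set_eq,
      Set.ncard_image_of_injective _ (gainMonomial_injective halg), Set.ncard_coe_finset,
      card_recvExponents]
  · rw [Set.disjoint_left]
    rintro _ ⟨_, ⟨s, -, -, -, rfl⟩, rfl⟩ ⟨t, ht, -, hst⟩
    have hexp := gainMonomial_injective halg ((gain_mul_gainMonomial h s i i).symm.trans hst)
    have hii := congrFun (congrFun hexp i) i
    simp [ht i] at hii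
end
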